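/- Let (u, b, p) be a smooth bounded solution of the stationary MHD/Hall–MHD system with parameter δ ∈ [0,1] on the slab ℝ²×𝕋, and suppose the swirl components u^θ and b^θ are axisymmetric. Then there is a constant C > 0, independent of R, such that for all R ≥ 2 one has |∫_{O_R} (p − p_R) u^r dx| ≤ C R^{1/2} ‖(∇u, ∇b)‖_{L²(O_R)} + C ‖∇u‖²_{L²(O_R)}, where p_R = (1/|O_R|) ∫_{O_R} p dx. -/

import Mathlib

open MeasureTheory

noncomputable section

/-- Points of `ℝ³`. -/
abbrev V3 : Type := Fin 3 → ℝ

/-- Partial derivative `∂ᵢ f`. -/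
def pd (i : Fin 3) (f : V3 → ℝ) (x : V3) : ℝ := fderiv ℝ f x (Pi.single i 1)

/-- Componentwise Laplacian. -/
def lap (f : V3 → ℝ) (x : V3) : ℝ := ∑ i, pd i (pd i f) x

/-- Cross product in `ℝ³`. -/
def cross3 (a c : V3) : V3 :=
  ![a 1 * c 2 - a 2 * c 1, a 2 * c 0 - a 0 * c 2, a 0 * c 1 - a 1 * c 0]

/-- Curl of a vector field. -/
def curl (b : V3 → V3) (x : V3) : V3 :=
  ![pd 1 (fun y => b y 2) x - pd 2 (fun y => b y 1) x,
    pd 2 (fun y => b y 0) x - pd 0 (fun y => b y 2) x,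
    pd 0 (fun y => b y 1) x - pd 1 (fun y => b y 0) x]

/-- Euclidean dot product in `ℝ³`. -/
def dot3 (a c : V3) : ℝ := ∑ i, a i * c i

/-- `|x'| = √(x₁² + x₂²)`. -/
def nr (x : V3) : ℝ := Real.sqrt ((x 0) ^ 2 + (x 1) ^ 2)

/-- The slab `ℝ² × [0,1]`. -/
def slab : Set V3 := {x | 0 ≤ x 2 ∧ x 2 ≤ 1}

/-- The region `{|x'| ≤ R} × [0,1]`. -/
def cylSet (R : ℝ) : Set V3 := {x | (0 ≤ x 2 ∧ x 2 ≤ 1) ∧ nr x ≤ R}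

/-- The annular region `O_R = {R-1 ≤ |x'| ≤ R} × [0,1]`. -/
def OR (R : ℝ) : Set V3 := {x | (0 ≤ x 2 ∧ x 2 ≤ 1) ∧ R - 1 ≤ nr x ∧ nr x ≤ R}

/-- The radial cut-off function `φ_R`. -/
def phiR (R : ℝ) (x : V3) : ℝ := min 1 (max 0 (R - nr x))

/-- `|∇u|² = Σ_{i,j} |∂ᵢ uʲ|²`. -/
def gradSq (u : V3 → V3) (x : V3) : ℝ := ∑ i, ∑ j, (pd i (fun y => u y j) x) ^ 2

/-- The `L²` norm of a scalar function on a set. -/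
def l2 (f : V3 → ℝ) (S : Set V3) : ℝ := Real.sqrt (∫ x in S, (f x) ^ 2)

/-- The radial component `u^r` as a function of `x`. -/
def ur (u : V3 → V3) (x : V3) : ℝ := (x 0 * u x 0 + x 1 * u x 1) / nr x

/-- The point with cylindrical coordinates `(r, θ, z)`. -/
def cylPt (r θ z : ℝ) : V3 := ![r * Real.cos θ, r * Real.sin θ, z]

/-- The radial component `u^r` in cylindrical coordinates. -/
def compR (u : V3 → V3) (r θ z : ℝ) : ℝ :=
  Real.cos θ * u (cylPt r θ z) 0 + Real.sin θ * u (cylPt r θ z) 1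

/-- The swirl component `u^θ` in cylindrical coordinates. -/
def compTheta (u : V3 → V3) (r θ z : ℝ) : ℝ :=
  -Real.sin θ * u (cylPt r θ z) 0 + Real.cos θ * u (cylPt r θ z) 1

/-- A cylindrical component is axisymmetric if it is independent of `θ`. -/
def AxiSym (f : ℝ → ℝ → ℝ → ℝ) : Prop := ∀ r θ₁ θ₂ z, f r θ₁ z = f r θ₂ z

/-- `1`-periodicity in the `x₃` variable. -/
def PeriodicZ (u : V3 → V3) : Prop := ∀ x : V3, u ![x 0, x 1, x 2 + 1] = u x

/-- Divergence-free vector field. -/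
def DivFree (u : V3 → V3) : Prop := ∀ x, ∑ i, pd i (fun y => u y i) x = 0

/-- Boundedness of a vector field. -/
def Bounded3 (u : V3 → V3) : Prop := ∃ M, ∀ x, ‖u x‖ ≤ M

/-- The stationary MHD (`δ = 0`) / Hall–MHD (`δ = 1`) system:
`(u·∇)u + ∇p − (b·∇)b − Δu = 0`,
`(u·∇)b − (b·∇)u − Δb = δ ∇×((∇×b)×b)`, `div u = div b = 0`. -/
def IsMHD (δ : ℝ) (u b : V3 → V3) (p : V3 → ℝ) : Prop :=
  (∀ x i, (∑ j, u x j * pd j (fun y => u y i) x) + pd i p x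
      - (∑ j, b x j * pd j (fun y => b y i) x) - lap (fun y => u y i) x = 0) ∧
  (∀ x i, (∑ j, u x j * pd j (fun y => b y i) x)
      - (∑ j, b x j * pd j (fun y => u y i) x) - lap (fun y => b y i) x
      = δ * curl (fun y => cross3 (curl b y) (b y)) x i) ∧
  DivFree u ∧ DivFree b

/-- Growth of the local Dirichlet integral: `∫_{{|x'|≤R}×[0,1]} |∇u|²+|∇b|² ≤ C R^α`. -/
def DirichletGrowth (u b : V3 → V3) : Prop :=
  ∃ C > (0:ℝ), ∃ α > (0:ℝ), ∀ R > (1:ℝ),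
    (∫ x in cylSet R, (gradSq u x + gradSq b x)) ≤ C * R ^ α

/-- Radial derivative `∂_r f = (x'/|x'|)·(∂₁f, ∂₂f)`. -/
def radD (f : V3 → ℝ) (x : V3) : ℝ := (x 0 / nr x) * pd 0 f x + (x 1 / nr x) * pd 1 f x

/-- The unit radial vector `(x'/|x'|, 0)`. -/
def er3 (x : V3) : V3 := ![x 0 / nr x, x 1 / nr x, 0]

/-- Squared Euclidean length of a vector of `ℝ³`. -/
def sq3 (v : V3) : ℝ := ∑ i, (v i) ^ 2

/-! ### Calculus of the partial derivatives -/

lemma pd_eq_of_hasFDerivAt {f : V3 → ℝ} {f' : V3 →L[ℝ] ℝ} {x : V3} (h : HasFDerivAt f f' x)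
    (i : Fin 3) : pd i f x = f' (Pi.single i 1) := by
  rw [pd, h.fderiv]

lemma hasDerivAt_line {f : V3 → ℝ} {x : V3} (hf : DifferentiableAt ℝ f x) (v : V3) :
    HasDerivAt (fun t : ℝ => f (x + t • v)) (fderiv ℝ f x v) 0 :=
  hf.hasFDerivAt.hasLineDerivAt v

lemma fderiv_apply_eq_sum_pd (f : V3 → ℝ) (x v : V3) :
    fderiv ℝ f x v = v 0 * pd 0 f x + v 1 * pd 1 f x + v 2 * pd 2 f x := by
  have h : v = v 0 • Pi.single 0 1 + v 1 • Pi.single 1 1 + v 2 • Pi.single 2 1 := by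
    ext i; fin_cases i <;> simp
  conv_lhs => rw [h]
  simp [pd]

lemma contDiff_pd {f : V3 → ℝ} (hf : ContDiff ℝ (⊤ : ℕ∞) f) (i : Fin 3) :
    ContDiff ℝ (⊤ : ℕ∞) (pd i f) := by
  have : ContDiff ℝ (⊤ : ℕ∞) (fderiv ℝ f) := hf.fderiv_right (by simp)
  exact this.clm_apply contDiff_const

lemma continuous_pd {f : V3 → ℝ} (hf : ContDiff ℝ 1 f) (i : Fin 3) :
    Continuous (pd i f) :=
  (hf.continuous_fderiv (by simp)).clm_apply continuous_const

lemma pd_add {f g : V3 → ℝ} {x : V3} (hf : DifferentiableAt ℝ f x) (hg : DifferentiableAt ℝ g x)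
    (i : Fin 3) : pd i (fun y => f y + g y) x = pd i f x + pd i g x := by
  simp [pd, fderiv_fun_add hf hg]

lemma pd_sub {f g : V3 → ℝ} {x : V3} (hf : DifferentiableAt ℝ f x) (hg : DifferentiableAt ℝ g x)
    (i : Fin 3) : pd i (fun y => f y - g y) x = pd i f x - pd i g x := by
  simp [pd, fderiv_fun_sub hf hg]

lemma pd_mul {f g : V3 → ℝ} {x : V3} (hf : DifferentiableAt ℝ f x) (hg : DifferentiableAt ℝ g x)
    (i : Fin 3) : pd i (fun y => f y * g y) x = f x * pd i g x + g x * pd i f x := by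
  simp [pd, fderiv_fun_mul hf hg]

lemma pd_sum {f : Fin 3 → V3 → ℝ} {x : V3} (hf : ∀ j, DifferentiableAt ℝ (f j) x)
    (i : Fin 3) : pd i (fun y => ∑ j, f j y) x = ∑ j, pd i (f j) x := by
  simp [pd, fderiv_fun_sum (fun j _ => hf j)]

lemma hasFDerivAt_coord (j : Fin 3) (x : V3) :
    HasFDerivAt (fun y : V3 => y j) (ContinuousLinearMap.proj j : V3 →L[ℝ] ℝ) x :=
  (ContinuousLinearMap.proj j : V3 →L[ℝ] ℝ).hasFDerivAt

lemma pd_coord (i j : Fin 3) (x : V3) : pd i (fun y => y j) x = if j = i then 1 else 0 := by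
  rw [pd_eq_of_hasFDerivAt (hasFDerivAt_coord j x)]
  simp [Pi.single_apply]

/-- Partial derivatives commute with translations. -/
lemma pd_add_const_arg (f : V3 → ℝ) (i : Fin 3) (v x : V3) :
    pd i (fun y => f (y + v)) x = pd i f (x + v) := by
  simp [pd, fderiv_comp_add_right]

/-! ### Integrals depending on a parameter -/

lemma hasFDerivAt_intervalIntegral_param {K : V3 × ℝ → ℝ} (hK : ContDiff ℝ 1 K) (a b : ℝ) (x : V3) :
    HasFDerivAt (fun y => ∫ t in a..b, K (y, t))
      (∫ t in a..b, (fderiv ℝ K (x, t)).comp (ContinuousLinearMap.inl ℝ V3 ℝ)) x := by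
  have hc : Continuous (fun q : V3 × ℝ =>
      (fderiv ℝ K q).comp (ContinuousLinearMap.inl ℝ V3 ℝ)) :=
    (hK.continuous_fderiv (by simp)).clm_comp continuous_const
  obtain ⟨M, hM⟩ := ((isCompact_closedBall x 1).prod (isCompact_uIcc (a := a) (b := b))
    ).exists_bound_of_continuousOn hc.continuousOn
  refine intervalIntegral.hasFDerivAt_integral_of_dominated_of_fderiv_le
    (F' := fun y t => (fderiv ℝ K (y, t)).comp (ContinuousLinearMap.inl ℝ V3 ℝ))
    (bound := fun _ => M) (Metric.closedBall_mem_nhds x one_pos) ?_ ?_ ?_ ?_ ?_ ?_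
  · exact Filter.Eventually.of_forall fun y =>
      (hK.continuous.comp (by fun_prop : Continuous fun t : ℝ => (y, t))).aestronglyMeasurable
  · exact (hK.continuous.comp (by fun_prop : Continuous fun t : ℝ => (x, t))).intervalIntegrable _ _
  · exact (hc.comp (by fun_prop : Continuous fun t : ℝ => (x, t))).aestronglyMeasurable
  · exact Filter.Eventually.of_forall fun t ht y hy =>
      hM (y, t) ⟨hy, Set.uIoc_subset_uIcc ht⟩
  · exact intervalIntegrable_const
  · refine Filter.Eventually.of_forall fun t _ y _ => ?_
    exact ((hK.differentiable (by simp)) (y, t)).hasFDerivAt.comp y (hasFDerivAt_prodMk_left y t)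

lemma contDiff_intervalIntegral_param {K : V3 × ℝ → ℝ} (hK : ContDiff ℝ 1 K) (a b : ℝ) :
    ContDiff ℝ 1 (fun y => ∫ t in a..b, K (y, t)) := by
  rw [contDiff_one_iff_fderiv]
  refine ⟨fun x => (hasFDerivAt_intervalIntegral_param hK a b x).differentiableAt, ?_⟩
  rw [show fderiv ℝ (fun y => ∫ t in a..b, K (y, t)) = _ from
    funext fun x => (hasFDerivAt_intervalIntegral_param hK a b x).fderiv]
  refine intervalIntegral.continuous_parametric_intervalIntegral_of_continuous' ?_ a b
  exact (hK.continuous_fderiv (by simp)).clm_comp continuous_const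

/-- The primitive in the vertical variable `∫₀^{x₃} k(x₁, x₂, s) ds`. -/
def primZ (k : V3 → ℝ) (x : V3) : ℝ := ∫ s in (0:ℝ)..x 2, k ![x 0, x 1, s]

lemma primZ_zero (k : V3 → ℝ) {x : V3} (hx : x 2 = 0) : primZ k x = 0 := by
  simp [primZ, hx]

lemma contDiff_vec (n : WithTop ℕ∞) : ContDiff ℝ n (fun q : V3 × ℝ => (![q.1 0, q.1 1, q.2] : V3)) := by
  rw [contDiff_pi]
  intro i
  fin_cases i <;> simp <;> fun_prop

lemma contDiff_primZ {k : V3 → ℝ} (hk : ContDiff ℝ 1 k) : ContDiff ℝ 1 (primZ k) := by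
  have h1 : primZ k = fun x => x 2 * ∫ t in (0:ℝ)..1, k ![x 0, x 1, t * x 2] := by
    ext x
    have := intervalIntegral.mul_integral_comp_mul_right (a := 0) (b := 1)
      (f := fun s => k ![x 0, x 1, s]) (c := x 2)
    simp only [zero_mul, one_mul] at this
    rw [primZ, ← this]
  rw [h1]
  refine ContDiff.mul (by fun_prop) ?_
  refine contDiff_intervalIntegral_param (K := fun q => k ![q.1 0, q.1 1, q.2 * q.1 2]) ?_ 0 1
  refine hk.comp ?_
  rw [contDiff_pi]
  intro i
  fin_cases i <;> simp <;> fun_prop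

lemma pd_primZ_two {k : V3 → ℝ} (hk : ContDiff ℝ 1 k) (x : V3) : pd 2 (primZ k) x = k x := by
  have h1 := hasDerivAt_line ((contDiff_primZ hk).differentiable (by simp) x) (Pi.single 2 1)
  have hc : Continuous fun s : ℝ => k ![x 0, x 1, s] :=
    hk.continuous.comp ((contDiff_vec 0).continuous.comp
      (by fun_prop : Continuous fun t : ℝ => (x, t)))
  have h2 : HasDerivAt (fun t : ℝ => ∫ s in (0:ℝ)..t, k ![x 0, x 1, s]) (k ![x 0, x 1, x 2]) (x 2) :=
    intervalIntegral.integral_hasDerivAt_right (hc.intervalIntegrable _ _)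
      hc.stronglyMeasurable.stronglyMeasurableAtFilter hc.continuousAt
  have h3 : HasDerivAt (fun t : ℝ => x 2 + t) 1 0 := (hasDerivAt_id _).const_add _
  have h4 := HasDerivAt.comp (0:ℝ) (h₂ := fun t : ℝ => ∫ s in (0:ℝ)..t, k ![x 0, x 1, s])
    (by simpa using h2) h3
  have h5 := h1.unique (h4.congr_of_eventuallyEq (Filter.Eventually.of_forall fun t => by
    simp [primZ]))
  have hx : (![x 0, x 1, x 2] : V3) = x := by ext i; fin_cases i <;> rfl
  rw [pd, h5, hx, mul_one]

lemma pd_primZ_horizontal {k : V3 → ℝ} (hk : ContDiff ℝ 1 k) {i : Fin 3} (hi : i ≠ 2) (x : V3) :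
    pd i (primZ k) x = primZ (pd i k) x := by
  have h1 := hasDerivAt_line ((contDiff_primZ hk).differentiable (by simp) x) (Pi.single i 1)
  have hK : ContDiff ℝ 1 (fun q : V3 × ℝ => k ![q.1 0, q.1 1, q.2]) := hk.comp (contDiff_vec 1)
  have h2 := hasFDerivAt_intervalIntegral_param hK 0 (x 2) x
  have h3 := hasDerivAt_line h2.differentiableAt (Pi.single i 1)
  rw [h2.fderiv] at h3
  have h4 := h1.unique (h3.congr_of_eventuallyEq (Filter.Eventually.of_forall fun t => by
    simp [primZ, Pi.single_eq_of_ne hi.symm]))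
  rw [pd, h4, ContinuousLinearMap.intervalIntegral_apply]
  · rw [primZ]
    congr 1
    ext s
    have h5 : HasFDerivAt (fun q : V3 × ℝ => (![q.1 0, q.1 1, q.2] : V3))
        (ContinuousLinearMap.pi ![(ContinuousLinearMap.proj 0).comp (ContinuousLinearMap.fst ℝ V3 ℝ),
          (ContinuousLinearMap.proj 1).comp (ContinuousLinearMap.fst ℝ V3 ℝ),
          ContinuousLinearMap.snd ℝ V3 ℝ]) (x, s) := by
      rw [hasFDerivAt_pi']
      intro j
      fin_cases j
      · exact (HasFDerivAt.comp (g := fun y : V3 => y 0) (x, s) (hasFDerivAt_coord 0 x)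
          (hasFDerivAt_fst (𝕜 := ℝ) (E := V3) (F := ℝ)) :)
      · exact (HasFDerivAt.comp (g := fun y : V3 => y 1) (x, s) (hasFDerivAt_coord 1 x)
          (hasFDerivAt_fst (𝕜 := ℝ) (E := V3) (F := ℝ)) :)
      · exact hasFDerivAt_snd
    have h6 := ((hk.differentiable (by simp)) ![x 0, x 1, s]).hasFDerivAt.comp (x, s) h5
    have h7 : fderiv ℝ (fun q : V3 × ℝ => k ![q.1 0, q.1 1, q.2]) (x, s) = _ := h6.fderiv
    rw [h7, pd]
    simp only [ContinuousLinearMap.comp_apply]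
    congr 1
    ext j
    fin_cases j <;> fin_cases i <;> simp at hi ⊢
  · exact Continuous.intervalIntegrable
      (((hK.continuous_fderiv (by simp)).comp
        (by fun_prop : Continuous fun t : ℝ => (x, t))).clm_comp continuous_const) _ _

/-! ### The divergence theorem on a box -/

lemma integral_box_divergence_eq_zero {a b : V3} (hab : a ≤ b) (F : Fin 3 → V3 → ℝ)
    (F' : Fin 3 → V3 → V3 →L[ℝ] ℝ) (hc : ∀ i, ContinuousOn (F i) (Set.Icc a b))
    (hd : ∀ x ∈ Set.univ.pi fun i => Set.Ioo (a i) (b i), ∀ i, HasFDerivAt (F i) (F' i x) x)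
    (hi : IntegrableOn (fun x => ∑ i, F' i x (Pi.single i 1)) (Set.Icc a b))
    (hF : ∀ i x, F i (Function.update x i (b i)) = F i (Function.update x i (a i))) :
    ∫ x in Set.Icc a b, ∑ i, F' i x (Pi.single i 1) = 0 := by
  rw [integral_divergence_of_hasFDerivAt_off_countable' a b hab F F' ∅ Set.countable_empty hc
    (fun x hx => hd x hx.1) hi]
  refine Finset.sum_eq_zero fun i _ => ?_
  rw [sub_eq_zero]
  congr 1
  ext y
  have := hF i (i.insertNth (a i) y)
  simpa using this

/-! ### Cylindrical coordinates -/

/-- The cylindrical coordinate map `(r, θ, z) ↦ (r cos θ, r sin θ, z)`. -/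
def cyl (y : V3) : V3 := cylPt (y 0) (y 1) (y 2)

lemma cyl_zero (y : V3) : cyl y 0 = y 0 * Real.cos (y 1) := rfl
lemma cyl_one (y : V3) : cyl y 1 = y 0 * Real.sin (y 1) := rfl
lemma cyl_two (y : V3) : cyl y 2 = y 2 := rfl

lemma contDiff_cyl : ContDiff ℝ (⊤ : ℕ∞) cyl := by
  rw [contDiff_pi]
  intro i
  fin_cases i
  · exact ContDiff.mul (by fun_prop) (Real.contDiff_cos.comp (by fun_prop))
  · exact ContDiff.mul (by fun_prop) (Real.contDiff_sin.comp (by fun_prop))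
  · exact contDiff_apply ℝ ℝ (2 : Fin 3)

lemma continuous_cyl : Continuous cyl := contDiff_cyl.continuous

lemma nr_sq (x : V3) : nr x ^ 2 = x 0 ^ 2 + x 1 ^ 2 := Real.sq_sqrt (by positivity)

lemma nr_nonneg (x : V3) : 0 ≤ nr x := Real.sqrt_nonneg _

lemma continuous_nr : Continuous nr := by unfold nr; fun_prop

lemma nr_cyl {y : V3} (hy : 0 ≤ y 0) : nr (cyl y) = y 0 := by
  rw [nr, cyl_zero, cyl_one]
  rw [show (y 0 * Real.cos (y 1)) ^ 2 + (y 0 * Real.sin (y 1)) ^ 2 = y 0 ^ 2 by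
    linear_combination (y 0) ^ 2 * Real.sin_sq_add_cos_sq (y 1)]
  exact Real.sqrt_sq hy

lemma exists_cyl (x : V3) : ∃ θ ∈ Set.Ioc (-Real.pi) Real.pi, cyl ![nr x, θ, x 2] = x := by
  let w : ℂ := ⟨x 0, x 1⟩
  have hw : ‖w‖ = nr x := by
    rw [Complex.norm_def, Complex.normSq_mk, nr]; congr 1; ring
  refine ⟨Complex.arg w, Complex.arg_mem_Ioc w, ?_⟩
  have h0 : nr x * Real.cos (Complex.arg w) = x 0 := hw ▸ Complex.norm_mul_cos_arg w
  have h1 : nr x * Real.sin (Complex.arg w) = x 1 := hw ▸ Complex.norm_mul_sin_arg w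
  ext i
  fin_cases i
  · exact h0
  · exact h1
  · rfl

/-- The derivative of the cylindrical coordinate map. -/
def cylDeriv (y : V3) : V3 →L[ℝ] V3 :=
  (Matrix.toLin' !![Real.cos (y 1), -(y 0 * Real.sin (y 1)), 0;
    Real.sin (y 1), y 0 * Real.cos (y 1), 0; 0, 0, 1]).toContinuousLinearMap

lemma hasFDerivAt_cyl (y : V3) : HasFDerivAt cyl (cylDeriv y) y := by
  rw [hasFDerivAt_pi']
  have h0 := hasFDerivAt_coord 0 y
  have h1 := hasFDerivAt_coord 1 y
  have h2 := hasFDerivAt_coord 2 y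
  intro i
  fin_cases i
  · refine (h0.mul h1.cos).congr_fderiv ?_
    ext v
    simp [cylDeriv, Matrix.vecHead, Matrix.vecTail]
    ring
  · refine (h0.mul h1.sin).congr_fderiv ?_
    ext v
    simp [cylDeriv, Matrix.vecHead, Matrix.vecTail]
    ring
  · refine h2.congr_fderiv ?_
    ext v
    simp [cylDeriv, Matrix.vecHead, Matrix.vecTail]

lemma det_cylDeriv (y : V3) : (cylDeriv y).det = y 0 := by
  have : (cylDeriv y).det = Matrix.det !![Real.cos (y 1), -(y 0 * Real.sin (y 1)), 0;
    Real.sin (y 1), y 0 * Real.cos (y 1), 0; 0, 0, 1] := by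
    rw [ContinuousLinearMap.det, cylDeriv, LinearMap.coe_toContinuousLinearMap, LinearMap.det_toLin']
  rw [this, Matrix.det_fin_three]
  simp
  linear_combination (y 0) * Real.sin_sq_add_cos_sq (y 1)

/-- Lower corner of the coordinate box of `O_R`. -/
def boxLo (R : ℝ) : V3 := ![R - 1, -Real.pi, 0]

/-- Upper corner of the coordinate box of `O_R`. -/
def boxHi (R : ℝ) : V3 := ![R, Real.pi, 1]

lemma boxLo_le_boxHi (R : ℝ) : boxLo R ≤ boxHi R := by
  intro i
  have := Real.pi_pos
  fin_cases i <;> simp [boxLo, boxHi]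
  linarith

/-- Half-open version of the coordinate box, on which `cyl` is injective. -/
def halfBox (R : ℝ) : Set V3 :=
  Set.univ.pi ![Set.Icc (R - 1) R, Set.Ioc (-Real.pi) Real.pi, Set.Icc 0 1]

lemma mem_halfBox {R : ℝ} {y : V3} : y ∈ halfBox R ↔
    y 0 ∈ Set.Icc (R - 1) R ∧ y 1 ∈ Set.Ioc (-Real.pi) Real.pi ∧ y 2 ∈ Set.Icc (0:ℝ) 1 := by
  simp [halfBox, Set.mem_pi, Fin.forall_fin_succ]

lemma mem_box {R : ℝ} {y : V3} : y ∈ Set.Icc (boxLo R) (boxHi R) ↔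
    y 0 ∈ Set.Icc (R - 1) R ∧ y 1 ∈ Set.Icc (-Real.pi) Real.pi ∧ y 2 ∈ Set.Icc (0:ℝ) 1 := by
  simp [boxLo, boxHi, Set.mem_Icc, Pi.le_def, Fin.forall_fin_succ]
  tauto

lemma halfBox_ae_eq (R : ℝ) : halfBox R =ᵐ[volume] Set.Icc (boxLo R) (boxHi R) := by
  rw [← Set.pi_univ_Icc, halfBox]
  refine Measure.ae_eq_set_pi fun i _ => ?_
  fin_cases i
  · exact Filter.EventuallyEq.rfl
  · exact Ioc_ae_eq_Icc
  · exact Filter.EventuallyEq.rfl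

lemma measurableSet_halfBox (R : ℝ) : MeasurableSet (halfBox R) := by
  refine MeasurableSet.univ_pi fun i => ?_
  fin_cases i
  · exact measurableSet_Icc
  · exact measurableSet_Ioc
  · exact measurableSet_Icc

lemma injOn_cyl {R : ℝ} (hR : 2 ≤ R) : Set.InjOn cyl (halfBox R) := by
  intro y hy y' hy' h
  rw [mem_halfBox] at hy hy'
  have hy0 : 0 < y 0 := by linarith [hy.1.1]
  have hy0' : 0 < y' 0 := by linarith [hy'.1.1]
  have e0 : y 0 = y' 0 := by rw [← nr_cyl hy0.le, h, nr_cyl hy0'.le]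
  have e2 : y 2 = y' 2 := by simpa [cyl_two] using congrFun h 2
  have ec : Real.cos (y 1) = Real.cos (y' 1) := by
    have := congrFun h 0
    rw [cyl_zero, cyl_zero, e0] at this
    exact mul_left_cancel₀ hy0'.ne' this
  have es : Real.sin (y 1) = Real.sin (y' 1) := by
    have := congrFun h 1
    rw [cyl_one, cyl_one, e0] at this
    exact mul_left_cancel₀ hy0'.ne' this
  have e1 : y 1 = y' 1 := by
    rw [← Complex.arg_cos_add_sin_mul_I hy.2.1, ← Complex.arg_cos_add_sin_mul_I hy'.2.1,
      ← Complex.ofReal_cos, ← Complex.ofReal_sin, ← Complex.ofReal_cos, ← Complex.ofReal_sin,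
      ec, es]
  ext i
  fin_cases i
  · exact e0
  · exact e1
  · exact e2

lemma image_cyl_halfBox {R : ℝ} (hR : 2 ≤ R) : cyl '' halfBox R = OR R := by
  ext x
  constructor
  · rintro ⟨y, hy, rfl⟩
    rw [mem_halfBox] at hy
    have hy0 : 0 ≤ y 0 := by linarith [hy.1.1]
    refine ⟨?_, ?_⟩
    · rw [cyl_two]; exact hy.2.2
    · rw [nr_cyl hy0]; exact hy.1
  · rintro ⟨h2, h0⟩
    obtain ⟨θ, hθ, h⟩ := exists_cyl x
    exact ⟨![nr x, θ, x 2], mem_halfBox.2 ⟨h0, hθ, h2⟩, h⟩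

/-- Integration over `O_R` in cylindrical coordinates. -/
lemma integral_OR_eq {R : ℝ} (hR : 2 ≤ R) (f : V3 → ℝ) :
    ∫ x in OR R, f x = ∫ y in Set.Icc (boxLo R) (boxHi R), y 0 * f (cyl y) := by
  rw [← image_cyl_halfBox hR, integral_image_eq_integral_abs_det_fderiv_smul volume
    (measurableSet_halfBox R) (fun y _ => (hasFDerivAt_cyl y).hasFDerivWithinAt) (injOn_cyl hR),
    ← setIntegral_congr_set (halfBox_ae_eq R)]
  refine setIntegral_congr_fun (measurableSet_halfBox R) fun y hy => ?_
  rw [mem_halfBox] at hy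
  simp only [det_cylDeriv, smul_eq_mul]
  rw [abs_of_nonneg (by linarith [hy.1.1])]

lemma isCompact_OR (R : ℝ) : IsCompact (OR R) := by
  have hcl : IsClosed (OR R) := by
    have h2 : Continuous fun x : V3 => x 2 := continuous_apply 2
    exact ((isClosed_le continuous_const h2).inter (isClosed_le h2 continuous_const)).inter
      ((isClosed_le continuous_const continuous_nr).inter (isClosed_le continuous_nr continuous_const))
  refine (isCompact_Icc (a := (fun _ => -(|R| + 1) : V3)) (b := fun _ => |R| + 1)).of_isClosed_subset
    hcl ?_
  rintro x ⟨⟨h2, h2'⟩, -, hr⟩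
  have hs := nr_sq x
  have hn := nr_nonneg x
  have h0 : |x 0| ≤ nr x := abs_le_of_sq_le_sq (by nlinarith [sq_nonneg (x 1)]) hn
  have h1 : |x 1| ≤ nr x := abs_le_of_sq_le_sq (by nlinarith [sq_nonneg (x 0)]) hn
  have hR := le_abs_self R
  rw [abs_le] at h0 h1
  refine ⟨fun i => ?_, fun i => ?_⟩ <;> fin_cases i <;> simp <;> linarith

lemma measurableSet_OR (R : ℝ) : MeasurableSet (OR R) := (isCompact_OR R).measurableSet

lemma volume_OR_le {R : ℝ} (hR : 2 ≤ R) : ∫ _ in OR R, (1:ℝ) ≤ 7 * R := by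
  rw [integral_OR_eq hR]
  have hv : (volume (Set.Icc (boxLo R) (boxHi R))).toReal = 2 * Real.pi := by
    rw [Real.volume_Icc_pi_toReal (boxLo_le_boxHi R)]
    simp [Fin.prod_univ_succ, boxLo, boxHi]
    ring
  have hfin : volume (Set.Icc (boxLo R) (boxHi R)) < ⊤ := isCompact_Icc.measure_lt_top
  calc _ ≤ ∫ y in Set.Icc (boxLo R) (boxHi R), R := by
        refine setIntegral_mono_on ?_ ?_ measurableSet_Icc ?_
        · exact Continuous.integrableOn_Icc (by fun_prop)
        · exact Continuous.integrableOn_Icc (by fun_prop)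
        · intro y hy
          rw [mem_box] at hy
          simpa using hy.1.2
    _ = 2 * Real.pi * R := by
        rw [setIntegral_const, smul_eq_mul, Measure.real, hv]
    _ ≤ 7 * R := by nlinarith [Real.pi_lt_d2]

/-- The divergence theorem on `O_R` for a field `ζ(|x'|) G` that is tangential on the lateral
boundary and periodic in the vertical variable. -/
theorem integral_OR_divergence {R : ℝ} (hR : 2 ≤ R) {G : Fin 3 → V3 → ℝ}
    (hG : ∀ i, ContDiff ℝ 1 (G i)) {ζ ζ' : ℝ → ℝ}
    (hζ : ∀ r ∈ Set.Icc (R - 1) R, HasDerivAt ζ (ζ' r) r)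
    (hζ' : ContinuousOn ζ' (Set.Icc (R - 1) R))
    (hlat : ∀ x, nr x = R ∨ nr x = R - 1 → ζ (nr x) * (x 0 * G 0 x + x 1 * G 1 x) = 0)
    (hper : ∀ x : V3, G 2 ![x 0, x 1, 1] = G 2 ![x 0, x 1, 0]) :
    ∫ x in OR R, (ζ (nr x) * ∑ i, pd i (G i) x
      + ζ' (nr x) * ((x 0 * G 0 x + x 1 * G 1 x) / nr x)) = 0 := by
  rw [integral_OR_eq hR]
  have hζc : ContinuousOn ζ (Set.Icc (R - 1) R) :=
    fun r hr => (hζ r hr).continuousAt.continuousWithinAt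
  let F : Fin 3 → V3 → ℝ := ![
    fun y => ζ (y 0) * (y 0 * Real.cos (y 1) * G 0 (cyl y) + y 0 * Real.sin (y 1) * G 1 (cyl y)),
    fun y => ζ (y 0) * (Real.cos (y 1) * G 1 (cyl y) - Real.sin (y 1) * G 0 (cyl y)),
    fun y => ζ (y 0) * (y 0 * G 2 (cyl y))]
  have hmaps : Set.MapsTo (fun y : V3 => y 0) (Set.Icc (boxLo R) (boxHi R)) (Set.Icc (R - 1) R) :=
    fun y hy => (mem_box.1 hy).1
  have hζy : ContinuousOn (fun y : V3 => ζ (y 0)) (Set.Icc (boxLo R) (boxHi R)) :=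
    hζc.comp (continuous_apply 0).continuousOn hmaps
  have hζy' : ContinuousOn (fun y : V3 => ζ' (y 0)) (Set.Icc (boxLo R) (boxHi R)) :=
    hζ'.comp (continuous_apply 0).continuousOn hmaps
  have hGc : ∀ i, Continuous fun y => G i (cyl y) := fun i =>
    (hG i).continuous.comp continuous_cyl
  have hpc : ∀ i j, Continuous fun y => pd j (G i) (cyl y) := fun i j =>
    (continuous_pd (hG i) j).comp continuous_cyl
  let E : V3 → ℝ := fun y => y 0 * (ζ (y 0) * (pd 0 (G 0) (cyl y) + pd 1 (G 1) (cyl y)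
      + pd 2 (G 2) (cyl y))) + ζ' (y 0) * (y 0 * Real.cos (y 1) * G 0 (cyl y)
      + y 0 * Real.sin (y 1) * G 1 (cyl y))
  have hEc : ContinuousOn E (Set.Icc (boxLo R) (boxHi R)) := by
    have a := hGc 0; have b := hGc 1
    have c := hpc 0 0; have d := hpc 1 1; have e := hpc 2 2
    refine ContinuousOn.add (ContinuousOn.mul (by fun_prop) (hζy.mul ?_)) (hζy'.mul ?_)
    · exact ((c.add d).add e).continuousOn
    · exact (((by fun_prop : Continuous fun y : V3 => y 0 * Real.cos (y 1)).mul a).add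
        ((by fun_prop : Continuous fun y : V3 => y 0 * Real.sin (y 1)).mul b)).continuousOn
  have hFd : ∀ y ∈ Set.univ.pi fun i => Set.Ioo (boxLo R i) (boxHi R i), ∀ i,
      DifferentiableAt ℝ (F i) y ∧ ∑ i, fderiv ℝ (F i) y (Pi.single i 1) = E y := by
    intro y hy
    have hy0 : y 0 ∈ Set.Icc (R - 1) R := by
      have := hy 0 (Set.mem_univ _)
      exact ⟨this.1.le, this.2.le⟩
    have c0 := hasFDerivAt_coord 0 y
    have hz : HasFDerivAt (fun y : V3 => ζ (y 0)) _ y := (hζ _ hy0).comp_hasFDerivAt y c0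
    have g : ∀ i, HasFDerivAt (fun y => G i (cyl y)) _ y := fun i =>
      (((hG i).differentiable (by simp)) (cyl y)).hasFDerivAt.comp y (hasFDerivAt_cyl y)
    have hco := (hasFDerivAt_coord 1 y).cos
    have hsi := (hasFDerivAt_coord 1 y).sin
    have f0 := hz.mul (((c0.mul hco).mul (g 0)).add ((c0.mul hsi).mul (g 1)))
    have f1 := hz.mul ((hco.mul (g 1)).sub (hsi.mul (g 0)))
    have f2 := hz.mul (c0.mul (g 2))
    intro i
    refine ⟨?_, ?_⟩
    · fin_cases i
      · exact f0.differentiableAt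
      · exact f1.differentiableAt
      · exact f2.differentiableAt
    · rw [Fin.sum_univ_three]
      rw [show fderiv ℝ (F 0) y = _ from f0.fderiv, show fderiv ℝ (F 1) y = _ from f1.fderiv,
        show fderiv ℝ (F 2) y = _ from f2.fderiv]
      simp [fderiv_apply_eq_sum_pd, cylDeriv, E]
      have hsc := Real.sin_sq_add_cos_sq (y 1)
      linear_combination (ζ (y 0) * y 0 * (pd 0 (G 0) (cyl y) + pd 1 (G 1) (cyl y))) * hsc
  have hEq : ∀ y ∈ Set.Icc (boxLo R) (boxHi R), y 0 * (ζ (nr (cyl y)) * ∑ i, pd i (G i) (cyl y)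
      + ζ' (nr (cyl y)) * ((cyl y 0 * G 0 (cyl y) + cyl y 1 * G 1 (cyl y)) / nr (cyl y))) = E y := by
    intro y hy
    have hy0 : 0 < y 0 := by linarith [(mem_box.1 hy).1.1]
    rw [nr_cyl hy0.le, Fin.sum_univ_three, cyl_zero, cyl_one]
    simp only [E]
    field_simp
  rw [setIntegral_congr_fun measurableSet_Icc hEq]
  have hsum : ∀ y ∈ Set.univ.pi fun i => Set.Ioo (boxLo R i) (boxHi R i),
      ∑ i, fderiv ℝ (F i) y (Pi.single i 1) = E y := fun y hy => (hFd y hy 0).2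
  have hae : (Set.univ.pi fun i => Set.Ioo (boxLo R i) (boxHi R i)) =ᵐ[volume]
      Set.Icc (boxLo R) (boxHi R) := Measure.univ_pi_Ioo_ae_eq_Icc
  have hmeas : MeasurableSet (Set.univ.pi fun i => Set.Ioo (boxLo R i) (boxHi R i)) :=
    MeasurableSet.univ_pi fun i => measurableSet_Ioo
  have hEi : IntegrableOn E (Set.Icc (boxLo R) (boxHi R)) := hEc.integrableOn_Icc
  rw [← setIntegral_congr_set hae, ← setIntegral_congr_fun hmeas hsum, setIntegral_congr_set hae]
  refine integral_box_divergence_eq_zero (boxLo_le_boxHi R) F (fun i => fderiv ℝ (F i)) ?_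
    (fun y hy i => (hFd y hy i).1.hasFDerivAt) ?_ ?_
  · have cc : Continuous fun y : V3 => Real.cos (y 1) := by fun_prop
    have cs : Continuous fun y : V3 => Real.sin (y 1) := by fun_prop
    have c0 : Continuous fun y : V3 => y 0 := by fun_prop
    intro i
    fin_cases i
    · exact hζy.mul (((c0.mul cc).mul (hGc 0)).add ((c0.mul cs).mul (hGc 1))).continuousOn
    · exact hζy.mul ((cc.mul (hGc 1)).sub (cs.mul (hGc 0))).continuousOn
    · exact hζy.mul (c0.mul (hGc 2)).continuousOn
  · rw [← integrableOn_congr_set_ae hae] at hEi ⊢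
    exact hEi.congr_fun (fun y hy => (hsum y hy).symm) hmeas
  · intro i y
    fin_cases i
    · have h : ∀ r, 0 ≤ r → (r = R ∨ r = R - 1) → F 0 (Function.update y 0 r) = 0 := by
        intro r hr hr'
        have := hlat (cyl (Function.update y 0 r))
        rw [nr_cyl (by simpa using hr)] at this
        simpa [F, cyl_zero, cyl_one] using this (by simpa using hr')
      change F 0 (Function.update y 0 R) = F 0 (Function.update y 0 (R - 1))
      rw [h R (by linarith) (Or.inl rfl), h (R - 1) (by linarith) (Or.inr rfl)]
    · have : cyl (Function.update y 1 Real.pi) = cyl (Function.update y 1 (-Real.pi)) := by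
        ext i
        fin_cases i <;> simp [cyl, cylPt]
      change F 1 (Function.update y 1 Real.pi) = F 1 (Function.update y 1 (-Real.pi))
      simp [F, this]
    · have := hper (cyl y)
      change F 2 (Function.update y 2 1) = F 2 (Function.update y 2 0)
      simpa [F, cyl, cylPt] using Or.inl (Or.inl this)

lemma contDiff_comp_apply {n : WithTop ℕ∞} {u : V3 → V3} (hu : ContDiff ℝ n u) (j : Fin 3) :
    ContDiff ℝ n (fun y => u y j) := contDiff_pi.1 hu j

lemma vec_eta (x : V3) : (![x 0, x 1, x 2] : V3) = x := by
  ext i; fin_cases i <;> rfl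

lemma vec_add_one (x : V3) : (![x 0, x 1, x 2 + 1] : V3) = x + Pi.single 2 1 := by
  ext i; fin_cases i <;> simp

lemma one_le_infty : (1 : WithTop ℕ∞) ≤ ((⊤ : ℕ∞) : WithTop ℕ∞) := by
  exact_mod_cast le_top

/-! ### Vanishing vertical mean of the radial component -/

/-- The infinitesimal form of the axisymmetry of the swirl component. -/
lemma swirl_identity {u : V3 → V3} (hu : ContDiff ℝ (⊤ : ℕ∞) u) (hax : AxiSym (compTheta u))
    (x : V3) :
    x 0 ^ 2 * pd 1 (fun y => u y 1) x + x 1 ^ 2 * pd 0 (fun y => u y 0) x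
      - x 0 * x 1 * (pd 1 (fun y => u y 0) x + pd 0 (fun y => u y 1) x)
      - (x 0 * u x 0 + x 1 * u x 1) = 0 := by
  obtain ⟨θ, -, hx⟩ := exists_cyl x
  set y : V3 := ![nr x, θ, x 2] with hy
  have hd : ∀ j, HasFDerivAt (fun y => u y j) _ x := fun j =>
    ((contDiff_comp_apply hu j).differentiable (by simp) x).hasFDerivAt
  have hh := ((hasFDerivAt_coord 0 x).mul (hd 1)).sub ((hasFDerivAt_coord 1 x).mul (hd 0))
  have hh' := hh
  rw [← hx] at hh'
  have hline := (hh'.comp y (hasFDerivAt_cyl y)).hasLineDerivAt (Pi.single 1 1)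
  have hconst : ∀ t : ℝ, ((fun y : V3 => y 0) * (fun y => u y 1) - (fun y : V3 => y 1) *
      (fun y => u y 0)) (cyl (y + t • Pi.single 1 1)) = nr x * compTheta u (nr x) θ (x 2) := by
    intro t
    rw [hax (nr x) θ (θ + t) (x 2)]
    simp [compTheta, cyl, cylPt, hy]
    ring
  have h0 := hline.unique ((hasDerivAt_const (0:ℝ) (nr x * compTheta u (nr x) θ (x 2))
    ).congr_of_eventuallyEq (Filter.Eventually.of_forall fun t => hconst t))
  have e0 : x 0 = nr x * Real.cos θ := by
    conv_lhs => rw [← hx]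
    rfl
  have e1 : x 1 = nr x * Real.sin θ := by
    conv_lhs => rw [← hx]
    rfl
  rw [hx] at h0
  simp [cylDeriv, fderiv_apply_eq_sum_pd, hy, ← e0, ← e1] at h0
  linear_combination h0

lemma contDiff_radial {u : V3 → V3} (hu : ContDiff ℝ (⊤ : ℕ∞) u) :
    ContDiff ℝ (⊤ : ℕ∞) (fun y => y 0 * u y 0 + y 1 * u y 1) := by
  have h0 := contDiff_comp_apply hu 0
  have h1 := contDiff_comp_apply hu 1
  fun_prop

lemma pd_radial {u : V3 → V3} (hu : ContDiff ℝ (⊤ : ℕ∞) u) (x : V3) (i : Fin 3) :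
    pd i (fun y => y 0 * u y 0 + y 1 * u y 1) x =
      x 0 * pd i (fun y => u y 0) x + u x 0 * (if 0 = i then 1 else 0)
      + (x 1 * pd i (fun y => u y 1) x + u x 1 * (if 1 = i then 1 else 0)) := by
  have h : ∀ j, DifferentiableAt ℝ (fun y => u y j) x := fun j =>
    (contDiff_comp_apply hu j).differentiable (by simp) x
  have c : ∀ j, DifferentiableAt ℝ (fun y : V3 => y j) x := fun j =>
    (hasFDerivAt_coord j x).differentiableAt
  rw [pd_add ((c 0).fun_mul (h 0)) ((c 1).fun_mul (h 1)), pd_mul (c 0) (h 0), pd_mul (c 1) (h 1),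
    pd_coord, pd_coord]

lemma continuous_slice {k : V3 → ℝ} (hk : Continuous k) (x : V3) :
    Continuous fun s : ℝ => k ![x 0, x 1, s] :=
  hk.comp ((contDiff_vec 0).continuous.comp (by fun_prop : Continuous fun t : ℝ => (x, t)))

lemma primZ_pd_two {f : V3 → ℝ} (hf : ContDiff ℝ 1 f) (x : V3) :
    primZ (pd 2 f) x = f x - f ![x 0, x 1, 0] := by
  have h : ∀ s ∈ Set.uIcc (0:ℝ) (x 2), HasDerivAt (fun s => f ![x 0, x 1, s])
      (pd 2 f ![x 0, x 1, s]) s := by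
    intro s _
    have h1 := hasDerivAt_line ((hf.differentiable (by simp)) ![x 0, x 1, s]) (Pi.single 2 1)
    have h2 : HasDerivAt (fun t : ℝ => t - s) 1 s := (hasDerivAt_id s).sub_const s
    have h3 := HasDerivAt.comp s (h₂ := fun t : ℝ => f (![x 0, x 1, s] + t • Pi.single 2 1))
      (by simpa using h1) h2
    rw [mul_one] at h3
    refine h3.congr_of_eventuallyEq (Filter.Eventually.of_forall fun t => ?_)
    simp only [Function.comp]
    congr 1
    ext i
    fin_cases i <;> simp
  rw [primZ, intervalIntegral.integral_eq_sub_of_hasDerivAt h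
    ((continuous_slice (continuous_pd hf 2) x).intervalIntegrable _ _), vec_eta]

lemma primZ_radial_eq_zero {u : V3 → V3} (hu : ContDiff ℝ (⊤ : ℕ∞) u) (hup : PeriodicZ u)
    (hdiv : DivFree u) (hax : AxiSym (compTheta u)) {x : V3} (hx : x 2 = 1) :
    primZ (fun y => y 0 * u y 0 + y 1 * u y 1) x = 0 := by
  set g : V3 → ℝ := fun y => y 0 * u y 0 + y 1 * u y 1 with hg
  have hgc : ContDiff ℝ 1 g := (contDiff_radial hu).of_le one_le_infty
  have hW := contDiff_primZ hgc
  have hu2 : ContDiff ℝ 1 (fun y => u y 2) := (contDiff_comp_apply hu 2).of_le one_le_infty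
  have key : ∀ y : V3, y 2 = 1 → y 0 * pd 0 (primZ g) y + y 1 * pd 1 (primZ g) y = 0 := by
    intro y hy
    rw [pd_primZ_horizontal hgc (by decide), pd_primZ_horizontal hgc (by decide)]
    have h1 : y 0 * primZ (pd 0 g) y + y 1 * primZ (pd 1 g) y
        = -(y 0 ^ 2 + y 1 ^ 2) * primZ (pd 2 (fun y => u y 2)) y := by
      have i0 := (continuous_slice (continuous_pd hgc 0) y).intervalIntegrable (μ := volume) 0 (y 2)
      have i1 := (continuous_slice (continuous_pd hgc 1) y).intervalIntegrable (μ := volume) 0 (y 2)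
      simp only [primZ]
      rw [← intervalIntegral.integral_const_mul, ← intervalIntegral.integral_const_mul,
        ← intervalIntegral.integral_const_mul,
        ← intervalIntegral.integral_add (i0.const_mul _) (i1.const_mul _)]
      congr 1
      ext s
      have hs := swirl_identity hu hax ![y 0, y 1, s]
      have hd := hdiv ![y 0, y 1, s]
      rw [Fin.sum_univ_three] at hd
      rw [hg, pd_radial hu, pd_radial hu]
      simp at hs hd ⊢
      linear_combination (y 0 ^ 2 + y 1 ^ 2) * hd - hs
    rw [h1, primZ_pd_two hu2]
    have h2 := hup ![y 0, y 1, 0]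
    simp at h2
    rw [← vec_eta y, hy, h2]
    simp
  have hcurve : ∀ t : ℝ, HasDerivAt (fun t : ℝ => primZ g ![t * x 0, t * x 1, 1])
      (x 0 * pd 0 (primZ g) ![t * x 0, t * x 1, 1] + x 1 * pd 1 (primZ g) ![t * x 0, t * x 1, 1])
      t := by
    intro t
    have h1 := ((hW.differentiable (by simp)) ![t * x 0, t * x 1, 1]).hasFDerivAt
    have h2 : HasDerivAt (fun t : ℝ => (![t * x 0, t * x 1, 1] : V3)) ![x 0, x 1, 0] t := by
      rw [hasDerivAt_pi]
      intro i
      fin_cases i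
      · simpa using (hasDerivAt_id t).mul_const (x 0)
      · simpa using (hasDerivAt_id t).mul_const (x 1)
      · simpa using hasDerivAt_const t (1:ℝ)
    have h3 := h1.comp_hasDerivAt t h2
    rw [fderiv_apply_eq_sum_pd] at h3
    simpa [Function.comp_def] using h3
  obtain ⟨t, ht, h⟩ := exists_hasDerivAt_eq_slope (fun t : ℝ => primZ g ![t * x 0, t * x 1, 1]) _
    (zero_lt_one) (fun t _ => (hcurve t).continuousAt.continuousWithinAt) (fun t _ => hcurve t)
  have hk := key ![t * x 0, t * x 1, 1] rfl
  simp at hk h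
  have h0 : x 0 * pd 0 (primZ g) ![t * x 0, t * x 1, 1]
      + x 1 * pd 1 (primZ g) ![t * x 0, t * x 1, 1] = 0 := by
    have : t * (x 0 * pd 0 (primZ g) ![t * x 0, t * x 1, 1]
      + x 1 * pd 1 (primZ g) ![t * x 0, t * x 1, 1]) = 0 := by linear_combination hk
    exact (mul_eq_zero.1 this).resolve_left ht.1.ne'
  rw [h0] at h
  have h00 : primZ g ![0, 0, 1] = 0 := by simp [primZ, hg]
  rw [h00, ← hx, vec_eta] at h
  linarith

/-! ### Periodicity of the pressure -/

lemma momentum_pd_pressure {δ : ℝ} {u b : V3 → V3} {p : V3 → ℝ} (hsol : IsMHD δ u b p) (i : Fin 3)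
    (x : V3) : pd i p x = lap (fun y => u y i) x - (∑ j, u x j * pd j (fun y => u y i) x)
      + ∑ j, b x j * pd j (fun y => b y i) x := by
  linear_combination hsol.1 x i

lemma pd_shift {f : V3 → ℝ} {v : V3} (hf : ∀ x, f (x + v) = f x) (i : Fin 3) (x : V3) :
    pd i f (x + v) = pd i f x := by
  rw [← pd_add_const_arg]
  simp only [hf]

lemma pressure_shift {δ : ℝ} {u b : V3 → V3} {p : V3 → ℝ} (hp : ContDiff ℝ (⊤ : ℕ∞) p)
    (hup : PeriodicZ u) (hbp : PeriodicZ b) (hsol : IsMHD δ u b p) :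
    ∃ c, ∀ x, p (x + Pi.single 2 1) = p x + c := by
  have hu : ∀ x, u (x + Pi.single 2 1) = u x := fun x => by rw [← vec_add_one, hup]
  have hb : ∀ x, b (x + Pi.single 2 1) = b x := fun x => by rw [← vec_add_one, hbp]
  have hpd : ∀ i x, pd i p (x + Pi.single 2 1) = pd i p x := by
    intro i x
    rw [momentum_pd_pressure hsol, momentum_pd_pressure hsol]
    have h1 : ∀ i j x, pd i (fun y => u y j) (x + Pi.single 2 1) = pd i (fun y => u y j) x :=
      fun i j x => pd_shift (fun x => by rw [hu]) i x
    have h2 : ∀ i j x, pd i (fun y => b y j) (x + Pi.single 2 1) = pd i (fun y => b y j) x :=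
      fun i j x => pd_shift (fun x => by rw [hb]) i x
    have h3 : ∀ i j x, pd i (pd i (fun y => u y j)) (x + Pi.single 2 1)
        = pd i (pd i (fun y => u y j)) x := fun i j x => pd_shift (fun x => h1 i j x) i x
    simp only [lap, h1, h2, h3, hu, hb]
  have hdiff : Differentiable ℝ p := hp.differentiable (by simp)
  have hshift : Differentiable ℝ fun x : V3 => p (x + Pi.single 2 1) := by fun_prop
  have hD : ∀ x, fderiv ℝ (fun x => p (x + Pi.single 2 1) - p x) x = 0 := by
    intro x
    ext v
    have h : ∀ i, pd i (fun x => p (x + Pi.single 2 1) - p x) x = 0 := fun i => by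
      rw [pd_sub (hshift x) (hdiff x), pd_add_const_arg, hpd, sub_self]
    rw [fderiv_apply_eq_sum_pd, h, h, h]
    simp
  refine ⟨p (0 + Pi.single 2 1) - p 0, fun x => ?_⟩
  have := is_const_of_fderiv_eq_zero (hshift.sub hdiff) hD x 0
  simp only [Pi.sub_apply] at this
  linarith

/-- A constant that cancels a bounded function in the mean is dominated by its bound. -/
lemma abs_le_of_setIntegral_add_eq_zero {S : Set V3} (hfin : volume S < ⊤)
    (hpos : volume S ≠ 0) {A β : ℝ} {B : V3 → ℝ} (hB : IntegrableOn B S)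
    (hbd : ∀ x ∈ S, |B x| ≤ β) (h0 : ∫ x in S, (A + B x) = 0) : |A| ≤ β := by
  have hA : Integrable (fun _ : V3 => A) (volume.restrict S) := integrableOn_const hfin.ne
  rw [integral_add hA hB, setIntegral_const] at h0
  have h1 := norm_setIntegral_le_of_norm_le_const hfin (f := B) (C := β) (fun x hx => hbd x hx)
  have hv : 0 < volume.real S := ENNReal.toReal_pos hpos hfin.ne
  rw [Real.norm_eq_abs, show ∫ x in S, B x = -(volume.real S * A) by
    rw [smul_eq_mul] at h0; linarith, abs_neg, abs_mul, abs_of_pos hv] at h1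
  nlinarith

/-- The vertical momentum flux tested against `s(x₁) s(x₂)` with `s(t) = t² (L - t)²` on a box of
side `L`: the constant vertical pressure slope `c` is `O(L⁻¹)`. -/
lemma pressure_slope_bound {w q : V3 → ℝ} {Y : Fin 3 → V3 → ℝ} {c M : ℝ}
    (hw : ContDiff ℝ (⊤ : ℕ∞) w) (hq : ContDiff ℝ 1 q) (hY : ∀ i, ContDiff ℝ 1 (Y i))
    (hM : ∀ x, |w x| ≤ M) (hYM : ∀ i x, |Y i x| ≤ M)
    (hper : ∀ x : V3, pd 2 w (Function.update x 2 1) + Y 2 (Function.update x 2 1)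
        - q (Function.update x 2 1)
      = pd 2 w (Function.update x 2 0) + Y 2 (Function.update x 2 0) - q (Function.update x 2 0))
    (hdiv : ∀ x, lap w x + ∑ i, pd i (Y i) x - pd 2 q x = c) {L : ℝ} (hL : 1 ≤ L) :
    |c| * L ≤ 7200 * M := by
  let s : ℝ → ℝ := fun t => L ^ 2 * t ^ 2 - 2 * L * t ^ 3 + t ^ 4
  let s' : ℝ → ℝ := fun t => 2 * L ^ 2 * t - 6 * L * t ^ 2 + 4 * t ^ 3
  let s'' : ℝ → ℝ := fun t => 2 * L ^ 2 - 12 * L * t + 12 * t ^ 2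
  let S : ℝ → ℝ := fun t => L ^ 2 * t ^ 3 / 3 - L * t ^ 4 / 2 + t ^ 5 / 5 - L ^ 4 * t / 30
  have hs : ∀ t, HasDerivAt s (s' t) t := fun t => by
    have := (((hasDerivAt_pow 2 t).const_mul (L ^ 2)).sub
      ((hasDerivAt_pow 3 t).const_mul (2 * L))).add (hasDerivAt_pow 4 t)
    refine this.congr_deriv ?_
    simp only [s']; push_cast; ring
  have hs' : ∀ t, HasDerivAt s' (s'' t) t := fun t => by
    have := (((hasDerivAt_id t).const_mul (2 * L ^ 2)).sub
      ((hasDerivAt_pow 2 t).const_mul (6 * L))).add ((hasDerivAt_pow 3 t).const_mul 4)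
    refine this.congr_deriv ?_
    simp only [s'']; push_cast; ring
  have hS : ∀ t, HasDerivAt S (s t - L ^ 4 / 30) t := fun t => by
    have := (((((hasDerivAt_pow 3 t).const_mul (L ^ 2)).div_const 3).sub
      (((hasDerivAt_pow 4 t).const_mul L).div_const 2)).add ((hasDerivAt_pow 5 t).div_const 5)).sub
      (((hasDerivAt_id t).const_mul (L ^ 4)).div_const 30)
    refine this.congr_deriv ?_
    simp only [s]; push_cast; ring
  have cs : Continuous s := by fun_prop
  have cs' : Continuous s' := by fun_prop
  have cs'' : Continuous s'' := by fun_prop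
  have cS : Continuous S := by fun_prop
  have hw1 : ContDiff ℝ 1 w := hw.of_le one_le_infty
  have hpw : ∀ i, ContDiff ℝ 1 (pd i w) := fun i => (contDiff_pd hw i).of_le one_le_infty
  let F : Fin 3 → V3 → ℝ := ![
    fun x => s (x 0) * s (x 1) * (pd 0 w x + Y 0 x) - s' (x 0) * s (x 1) * w x
      - c * (S (x 0) * s (x 1)),
    fun x => s (x 0) * s (x 1) * (pd 1 w x + Y 1 x) - s (x 0) * s' (x 1) * w x
      - c * (L ^ 4 / 30) * S (x 1),
    fun x => s (x 0) * s (x 1) * (pd 2 w x + Y 2 x - q x)]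
  let B : V3 → ℝ := fun x => s' (x 0) * s (x 1) * Y 0 x + s (x 0) * s' (x 1) * Y 1 x
    - (s'' (x 0) * s (x 1) + s (x 0) * s'' (x 1)) * w x
  have hF : ∀ x, (∀ i, DifferentiableAt ℝ (F i) x) ∧
      ∑ i, fderiv ℝ (F i) x (Pi.single i 1) = c * (L ^ 8 / 900) + B x := by
    intro x
    have d0 : HasFDerivAt (fun x : V3 => s (x 0)) _ x :=
      (hs _).comp_hasFDerivAt x (hasFDerivAt_coord 0 x)
    have d1 : HasFDerivAt (fun x : V3 => s (x 1)) _ x :=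
      (hs _).comp_hasFDerivAt x (hasFDerivAt_coord 1 x)
    have d0' : HasFDerivAt (fun x : V3 => s' (x 0)) _ x :=
      (hs' _).comp_hasFDerivAt x (hasFDerivAt_coord 0 x)
    have d1' : HasFDerivAt (fun x : V3 => s' (x 1)) _ x :=
      (hs' _).comp_hasFDerivAt x (hasFDerivAt_coord 1 x)
    have D0 : HasFDerivAt (fun x : V3 => S (x 0)) _ x :=
      (hS _).comp_hasFDerivAt x (hasFDerivAt_coord 0 x)
    have D1 : HasFDerivAt (fun x : V3 => S (x 1)) _ x :=
      (hS _).comp_hasFDerivAt x (hasFDerivAt_coord 1 x)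
    have dw := (hw1.differentiable (by simp) x).hasFDerivAt
    have dq := (hq.differentiable (by simp) x).hasFDerivAt
    have dp := fun i => ((hpw i).differentiable (by simp) x).hasFDerivAt
    have dY := fun i => ((hY i).differentiable (by simp) x).hasFDerivAt
    have f0 := (((d0.mul d1).mul ((dp 0).add (dY 0))).sub ((d0'.mul d1).mul dw)).sub
      ((D0.mul d1).const_mul c)
    have f1 := (((d0.mul d1).mul ((dp 1).add (dY 1))).sub ((d0.mul d1').mul dw)).sub
      (D1.const_mul (c * (L ^ 4 / 30)))
    have f2 := (d0.mul d1).mul (((dp 2).add (dY 2)).sub dq)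
    refine ⟨fun i => ?_, ?_⟩
    · fin_cases i
      · exact f0.differentiableAt
      · exact f1.differentiableAt
      · exact f2.differentiableAt
    · rw [Fin.sum_univ_three]
      rw [show fderiv ℝ (F 0) x = _ from f0.fderiv, show fderiv ℝ (F 1) x = _ from f1.fderiv,
        show fderiv ℝ (F 2) x = _ from f2.fderiv]
      have h := hdiv x
      rw [lap, Fin.sum_univ_three, Fin.sum_univ_three] at h
      simp [fderiv_apply_eq_sum_pd, B]
      linear_combination s (x 0) * s (x 1) * h
  have hle : (0 : V3) ≤ ![L, L, 1] := by
    intro i; fin_cases i <;> simp <;> linarith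
  have hBc : Continuous B := by
    have h0 := (hY 0).continuous
    have h1 := (hY 1).continuous
    have h2 := hw1.continuous
    fun_prop
  have hBi : IntegrableOn B (Set.Icc 0 ![L, L, 1]) := hBc.integrableOn_Icc
  have hzero := integral_box_divergence_eq_zero hle F (fun i => fderiv ℝ (F i))
    (fun i x _ => ((hF x).1 i).continuousAt.continuousWithinAt)
    (fun x _ i => ((hF x).1 i).hasFDerivAt)
    (by
      simp only [(hF _).2]
      exact (continuous_const.add hBc).integrableOn_Icc)
    (by
      intro i x
      have e0 : s 0 = 0 := by simp [s]
      have e1 : s L = 0 := by simp only [s]; ring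
      have e2 : s' 0 = 0 := by simp [s']
      have e3 : s' L = 0 := by simp only [s']; ring
      have e4 : S 0 = 0 := by simp [S]
      have e5 : S L = 0 := by simp only [S]; ring
      fin_cases i
      · simp [F, e0, e1, e2, e3, e4, e5]
      · simp [F, e0, e1, e2, e3, e4, e5]
      · have := hper x
        simp [F, this])
  simp only [(hF _).2] at hzero
  have hpos : volume (Set.Icc (0:V3) ![L, L, 1]) ≠ 0 := by
    rw [Real.volume_Icc_pi]
    simp [Fin.prod_univ_succ]
    linarith
  have hM0 : 0 ≤ M := (abs_nonneg _).trans (hM 0)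
  have hb : ∀ t ∈ Set.Icc 0 L, |s t| ≤ L ^ 4 ∧ |s' t| ≤ 2 * L ^ 3 ∧ |s'' t| ≤ 2 * L ^ 2 := by
    intro t ht
    have hw0 : 0 ≤ t * (L - t) := mul_nonneg ht.1 (by linarith [ht.2])
    have hw1 : t * (L - t) ≤ L ^ 2 / 4 := by nlinarith [sq_nonneg (L - 2 * t)]
    have hlt : |L - 2 * t| ≤ L := abs_le.2 ⟨by linarith [ht.2], by linarith [ht.1]⟩
    refine ⟨?_, ?_, ?_⟩
    · rw [show s t = (t * (L - t)) ^ 2 by simp only [s]; ring, abs_of_nonneg (sq_nonneg _)]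
      nlinarith
    · rw [show s' t = 2 * (t * (L - t)) * (L - 2 * t) by simp only [s']; ring, abs_mul,
        abs_of_nonneg (by positivity)]
      calc _ ≤ 2 * (L ^ 2 / 4) * L := by gcongr
        _ ≤ 2 * L ^ 3 := by nlinarith [pow_pos (by linarith : 0 < L) 3]
    · rw [show s'' t = 2 * L ^ 2 - 12 * (t * (L - t)) by simp only [s'']; ring, abs_le]
      constructor <;> nlinarith
  have := abs_le_of_setIntegral_add_eq_zero (A := c * (L ^ 8 / 900)) (β := 8 * L ^ 7 * M)
    isCompact_Icc.measure_lt_top hpos hBi (by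
      intro x hx
      have hx0 : x 0 ∈ Set.Icc 0 L := ⟨hx.1 0, hx.2 0⟩
      have hx1 : x 1 ∈ Set.Icc 0 L := ⟨hx.1 1, hx.2 1⟩
      obtain ⟨a0, a1, a2⟩ := hb _ hx0
      obtain ⟨b0, b1, b2⟩ := hb _ hx1
      have y0 := hYM 0 x
      have y1 := hYM 1 x
      have w0 := hM x
      calc |B x| ≤ |s' (x 0) * s (x 1) * Y 0 x| + |s (x 0) * s' (x 1) * Y 1 x|
            + |(s'' (x 0) * s (x 1) + s (x 0) * s'' (x 1)) * w x| :=
            (abs_sub _ _).trans (by gcongr; exact abs_add_le _ _)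
        _ ≤ |s' (x 0)| * |s (x 1)| * |Y 0 x| + |s (x 0)| * |s' (x 1)| * |Y 1 x|
            + (|s'' (x 0)| * |s (x 1)| + |s (x 0)| * |s'' (x 1)|) * |w x| := by
            simp only [abs_mul]
            gcongr
            refine (abs_add_le _ _).trans ?_
            simp only [abs_mul, le_refl]
        _ ≤ (2 * L ^ 3) * L ^ 4 * M + L ^ 4 * (2 * L ^ 3) * M
            + ((2 * L ^ 2) * L ^ 4 + L ^ 4 * (2 * L ^ 2)) * M := by gcongr
        _ ≤ 8 * L ^ 7 * M := by
            have : L ^ 6 * M ≤ L ^ 7 * M :=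
              mul_le_mul_of_nonneg_right (pow_le_pow_right₀ hL (by norm_num)) hM0
            nlinarith) hzero
  rw [abs_mul, abs_of_nonneg (by positivity : (0:ℝ) ≤ L ^ 8 / 900)] at this
  have hL7 : 0 < L ^ 7 := by positivity
  refine le_of_mul_le_mul_left ?_ hL7
  have e : L ^ 7 * (|c| * L) = 900 * (|c| * (L ^ 8 / 900)) := by ring
  linarith

/-- A bounded flow leaves no room for a vertical pressure slope: the pressure is periodic. -/
lemma pressure_periodic {δ : ℝ} {u b : V3 → V3} {p : V3 → ℝ}
    (hu : ContDiff ℝ (⊤ : ℕ∞) u) (hb : ContDiff ℝ (⊤ : ℕ∞) b) (hp : ContDiff ℝ (⊤ : ℕ∞) p)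
    (hubd : Bounded3 u) (hbbd : Bounded3 b)
    (hup : PeriodicZ u) (hbp : PeriodicZ b) (hsol : IsMHD δ u b p) (x : V3) :
    p (x + Pi.single 2 1) = p x := by
  obtain ⟨c, hc⟩ := pressure_shift hp hup hbp hsol
  suffices c = 0 by rw [hc, this, add_zero]
  obtain ⟨M₁, hM₁⟩ := hubd
  obtain ⟨M₂, hM₂⟩ := hbbd
  have hu' : ∀ x, u (x + Pi.single 2 1) = u x := fun x => by rw [← vec_add_one, hup]
  have hb' : ∀ x, b (x + Pi.single 2 1) = b x := fun x => by rw [← vec_add_one, hbp]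
  have cu := fun j => (contDiff_comp_apply hu j)
  have cb := fun j => (contDiff_comp_apply hb j)
  have du : ∀ j, Differentiable ℝ fun y => u y j := fun j => (cu j).differentiable (by simp)
  have db : ∀ j, Differentiable ℝ fun y => b y j := fun j => (cb j).differentiable (by simp)
  have dp : Differentiable ℝ p := hp.differentiable (by simp)
  have bu : ∀ j x, |u x j| ≤ M₁ := fun j x => (norm_le_pi_norm (u x) j).trans (hM₁ x)
  have bb : ∀ j x, |b x j| ≤ M₂ := fun j x => (norm_le_pi_norm (b x) j).trans (hM₂ x)
  have hM₁0 : 0 ≤ M₁ := (abs_nonneg _).trans (bu 0 0)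
  have hM₂0 : 0 ≤ M₂ := (abs_nonneg _).trans (bb 0 0)
  have key : ∀ L : ℝ, 1 ≤ L → |c| * L ≤ 7200 * (M₁ + M₁ * M₁ + M₂ * M₂) := by
    intro L hL
    refine pressure_slope_bound (w := fun y => u y 2) (q := fun y => p y - c * y 2)
      (Y := fun j y => b y j * b y 2 - u y j * u y 2) (cu 2) ?_ ?_ ?_ ?_ ?_ ?_ hL
    · exact (hp.of_le one_le_infty).sub (by fun_prop)
    · exact fun i => (((cb i).mul (cb 2)).sub ((cu i).mul (cu 2))).of_le one_le_infty
    · intro x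
      nlinarith [bu 2 x]
    · intro i x
      calc _ ≤ |b x i * b x 2| + |u x i * u x 2| := abs_sub _ _
        _ ≤ M₂ * M₂ + M₁ * M₁ := by
          rw [abs_mul, abs_mul]
          have := bu i x; have := bu 2 x; have := bb i x; have := bb 2 x
          gcongr
        _ ≤ _ := by linarith
    · intro x
      have e : Function.update x 2 1 = Function.update x 2 0 + Pi.single 2 (1:ℝ) := by
        ext i; fin_cases i <;> simp
      have h2 := pd_shift (f := fun y => u y 2) (fun x => by rw [hu']) 2 (Function.update x 2 0)
      rw [e, h2, hu', hb', hc]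
      simp
    · intro x
      have hpd : pd 2 (fun y => p y - c * y 2) x = pd 2 p x - c := by
        rw [pd_sub (dp x) (by fun_prop), pd_mul (by fun_prop) (by fun_prop), pd_coord]
        simp [pd]
      have hY : ∀ i, pd i (fun y => b y i * b y 2 - u y i * u y 2) x
          = b x i * pd i (fun y => b y 2) x + b x 2 * pd i (fun y => b y i) x
            - (u x i * pd i (fun y => u y 2) x + u x 2 * pd i (fun y => u y i) x) := by
        intro i
        rw [pd_sub ((db i x).fun_mul (db 2 x)) ((du i x).fun_mul (du 2 x)), pd_mul (db i x) (db 2 x),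
          pd_mul (du i x) (du 2 x)]
      have h1 := hsol.2.2.1 x
      have h2 := hsol.2.2.2 x
      rw [hpd, momentum_pd_pressure hsol]
      simp only [hY]
      simp only [Fin.sum_univ_three] at h1 h2 ⊢
      linear_combination b x 2 * h2 - u x 2 * h1
  by_contra hne
  have hpos : 0 < |c| := abs_pos.2 hne
  set N := 7200 * (M₁ + M₁ * M₁ + M₂ * M₂)
  have hN : 0 ≤ N := by positivity
  have := key (N / |c| + 1) (by have : 0 ≤ N / |c| := by positivity
                                linarith)
  rw [mul_add, mul_div_cancel₀ _ hpos.ne'] at this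
  linarith

/-! ### Consequences of the divergence theorem on `O_R` -/

lemma one_le_nr {R : ℝ} (hR : 2 ≤ R) {x : V3} (hx : x ∈ OR R) : 1 ≤ nr x := by
  linarith [hx.2.1]

lemma integrableOn_OR_divergence {R : ℝ} (hR : 2 ≤ R) {G : Fin 3 → V3 → ℝ}
    (hG : ∀ i, ContDiff ℝ 1 (G i)) {ζ ζ' : ℝ → ℝ} (hζ : ContinuousOn ζ (Set.Icc (R - 1) R))
    (hζ' : ContinuousOn ζ' (Set.Icc (R - 1) R)) :
    IntegrableOn (fun x => ζ (nr x) * ∑ i, pd i (G i) x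
      + ζ' (nr x) * ((x 0 * G 0 x + x 1 * G 1 x) / nr x)) (OR R) := by
  refine ContinuousOn.integrableOn_compact (isCompact_OR R) ?_
  have hm : Set.MapsTo nr (OR R) (Set.Icc (R - 1) R) := fun x hx => hx.2
  have h1 := hζ.comp continuous_nr.continuousOn hm
  have h2 := hζ'.comp continuous_nr.continuousOn hm
  have h3 : Continuous fun x => ∑ i, pd i (G i) x :=
    continuous_finsetSum _ fun i _ => continuous_pd (hG i) i
  have h4 : Continuous fun x : V3 => x 0 * G 0 x + x 1 * G 1 x := by
    have := (hG 0).continuous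
    have := (hG 1).continuous
    fun_prop
  exact (h1.mul h3.continuousOn).add (h2.mul (h4.continuousOn.div continuous_nr.continuousOn
    fun x hx => by linarith [one_le_nr hR hx]))

lemma integral_OR_pd_two {R : ℝ} (hR : 2 ≤ R) {h : V3 → ℝ} (hh : ContDiff ℝ 1 h)
    (hper : ∀ x : V3, h ![x 0, x 1, 1] = h ![x 0, x 1, 0]) {ζ ζ' : ℝ → ℝ}
    (hζ : ∀ r ∈ Set.Icc (R - 1) R, HasDerivAt ζ (ζ' r) r)
    (hζ' : ContinuousOn ζ' (Set.Icc (R - 1) R)) :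
    ∫ x in OR R, ζ (nr x) * pd 2 h x = 0 := by
  have := integral_OR_divergence hR (G := ![fun _ => 0, fun _ => 0, h])
    (fun i => by
      fin_cases i
      · exact contDiff_const
      · exact contDiff_const
      · exact hh) hζ hζ' (fun x _ => by simp) hper
  rw [← this]
  congr 1
  ext x
  simp [Fin.sum_univ_three, pd]

/-- The radial component has vanishing mean over `O_R`. -/
lemma integral_OR_ur {u : V3 → V3} (hu : ContDiff ℝ (⊤ : ℕ∞) u) (hup : PeriodicZ u)
    (hdiv : DivFree u) (hax : AxiSym (compTheta u)) {R : ℝ} (hR : 2 ≤ R) :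
    ∫ x in OR R, ur u x = 0 := by
  have hg : ContDiff ℝ 1 (fun y => y 0 * u y 0 + y 1 * u y 1) :=
    (contDiff_radial hu).of_le one_le_infty
  have h := integral_OR_pd_two hR (contDiff_primZ hg)
    (fun x => by rw [primZ_radial_eq_zero hu hup hdiv hax rfl, primZ_zero _ rfl])
    (ζ := fun r => r⁻¹) (ζ' := fun r => -(r ^ 2)⁻¹)
    (fun r hr => hasDerivAt_inv (by linarith [hr.1]))
    (ContinuousOn.neg (ContinuousOn.inv₀ (by fun_prop) fun r hr => by
      have : 0 < r := by linarith [hr.1]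
      positivity))
  rw [← h]
  congr 1
  ext x
  rw [pd_primZ_two hg, ur, div_eq_inv_mul]

/-- The integral of `k` over the vertical segment through `x`. -/
def fiberInt (k : V3 → ℝ) (x : V3) : ℝ := primZ k ![x 0, x 1, 1]

lemma contDiff_fiberInt {k : V3 → ℝ} (hk : ContDiff ℝ 1 k) : ContDiff ℝ 1 (fiberInt k) :=
  (contDiff_primZ hk).comp ((contDiff_vec 1).comp (by fun_prop : ContDiff ℝ 1 fun x : V3 => (x, (1:ℝ))))

lemma integral_OR_fiberInt {k : V3 → ℝ} (hk : ContDiff ℝ 1 k) {R : ℝ} (hR : 2 ≤ R) :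
    ∫ x in OR R, fiberInt k x = ∫ x in OR R, k x := by
  have hm := contDiff_fiberInt hk
  have hkm : ContDiff ℝ 1 fun x => k x - fiberInt k x := hk.sub hm
  have h := integral_OR_pd_two hR (contDiff_primZ hkm) (fun x => by
    rw [primZ_zero _ (x := ![x 0, x 1, 0]) rfl, primZ]
    simp only [Matrix.cons_val_zero, Matrix.cons_val_one, Matrix.cons_val]
    rw [intervalIntegral.integral_sub ((continuous_slice hk.continuous x).intervalIntegrable _ _)
      ((continuous_slice hm.continuous x).intervalIntegrable _ _)]
    simp [fiberInt, primZ])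
    (ζ := fun _ => 1) (ζ' := fun _ => 0) (fun r _ => hasDerivAt_const r 1) continuousOn_const
  simp only [pd_primZ_two hkm, one_mul] at h
  rw [integral_sub (hk.continuous.continuousOn.integrableOn_compact (isCompact_OR R))
    (hm.continuous.continuousOn.integrableOn_compact (isCompact_OR R))] at h
  linarith

lemma abs_setIntegral_le_of_integral_eq_zero {S : Set V3} (hS : MeasurableSet S)
    {f F₁ F₂ h : V3 → ℝ} (hf : IntegrableOn f S) (h₁ : IntegrableOn F₁ S) (h₂ : IntegrableOn F₂ S)
    (hh : IntegrableOn h S) (e₁ : ∫ x in S, F₁ x = 0) (e₂ : ∫ x in S, F₂ x = 0)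
    (hle : ∀ x ∈ S, |f x - F₁ x + F₂ x| ≤ h x) : |∫ x in S, f x| ≤ ∫ x in S, h x := by
  have e : ∫ x in S, (f x - F₁ x + F₂ x) = ∫ x in S, f x := by
    have h₀ : IntegrableOn (fun x => f x - F₁ x) S := hf.sub h₁
    rw [integral_add h₀ h₂, integral_sub hf h₁, e₁, e₂]
    ring
  rw [← e, ← Real.norm_eq_abs]
  exact norm_integral_le_of_norm_le hh ((ae_restrict_iff' hS).2 (Filter.Eventually.of_forall hle))

/-- Cauchy–Schwarz on `O_R`. -/
lemma integral_OR_sqrt_le {R : ℝ} (hR : 2 ≤ R) {f : V3 → ℝ} (hf : Continuous f) (h0 : ∀ x, 0 ≤ f x) :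
    ∫ x in OR R, Real.sqrt (f x) ≤ 3 * Real.sqrt R * Real.sqrt (∫ x in OR R, f x) := by
  have i1 : IntegrableOn f (OR R) := hf.continuousOn.integrableOn_compact (isCompact_OR R)
  have i2 : IntegrableOn (fun x => Real.sqrt (f x)) (OR R) :=
    hf.sqrt.continuousOn.integrableOn_compact (isCompact_OR R)
  have i3 : IntegrableOn (fun _ => (1:ℝ)) (OR R) :=
    continuousOn_const.integrableOn_compact (isCompact_OR R)
  set J := ∫ x in OR R, f x
  set I := ∫ x in OR R, Real.sqrt (f x)
  have hJ : 0 ≤ J := integral_nonneg h0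
  have hI : 0 ≤ I := integral_nonneg fun x => Real.sqrt_nonneg _
  have hV := volume_OR_le hR
  have hq : ∀ t : ℝ, 0 ≤ J - 2 * t * I + t ^ 2 * (7 * R) := by
    intro t
    have h : 0 ≤ ∫ x in OR R, (f x - 2 * t * Real.sqrt (f x) + t ^ 2 * 1) := by
      refine integral_nonneg fun x => ?_
      have := sq_nonneg (Real.sqrt (f x) - t)
      have e := Real.sq_sqrt (h0 x)
      show 0 ≤ f x - 2 * t * Real.sqrt (f x) + t ^ 2 * 1
      nlinarith
    have i4 : IntegrableOn (fun x => f x - 2 * t * Real.sqrt (f x)) (OR R) :=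
      i1.sub (i2.const_mul _)
    rw [integral_add i4 (i3.const_mul _), integral_sub i1 (i2.const_mul _),
      integral_const_mul, integral_const_mul] at h
    nlinarith [sq_nonneg t]
  have hsq : I ^ 2 ≤ 7 * R * J := by
    have h := hq (I / (7 * R))
    have hR0 : 0 < 7 * R := by linarith
    have e : J - 2 * (I / (7 * R)) * I + (I / (7 * R)) ^ 2 * (7 * R) = J - I ^ 2 / (7 * R) := by
      field_simp
      ring
    rw [e, sub_nonneg, div_le_iff₀ hR0] at h
    linarith
  refine abs_le_of_sq_le_sq' ?_ (by positivity) |>.2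
  rw [mul_pow, mul_pow, Real.sq_sqrt (by linarith), Real.sq_sqrt hJ]
  nlinarith

/-! ### Divergences of the two fluxes -/

/-- The energy flux `p u - ∇(|u|²/2)`. -/
def energyFlux (u : V3 → V3) (p : V3 → ℝ) (i : Fin 3) (y : V3) : ℝ :=
  p y * u y i - ∑ j, u y j * pd i (fun z => u z j) y

/-- The flux `W (∇u₃ - p e₃)`. -/
def verticalFlux (u : V3 → V3) (p W : V3 → ℝ) (i : Fin 3) (y : V3) : ℝ :=
  W y * (pd i (fun z => u z 2) y - if i = 2 then p y else 0)

/-- The transport term `(u·∇)uⁱ - (b·∇)bⁱ`. -/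
def transport (u b : V3 → V3) (i : Fin 3) (x : V3) : ℝ :=
  (∑ j, u x j * pd j (fun y => u y i) x) - ∑ j, b x j * pd j (fun y => b y i) x

lemma contDiff_energyFlux {u : V3 → V3} {p : V3 → ℝ} (hu : ContDiff ℝ (⊤ : ℕ∞) u)
    (hp : ContDiff ℝ (⊤ : ℕ∞) p) (i : Fin 3) : ContDiff ℝ 1 (energyFlux u p i) := by
  have h := contDiff_comp_apply hu
  refine ContDiff.of_le ?_ one_le_infty
  exact (hp.mul (h i)).sub (ContDiff.sum fun j _ => (h j).mul (contDiff_pd (h j) i))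

lemma contDiff_verticalFlux {u : V3 → V3} {p W : V3 → ℝ} (hu : ContDiff ℝ (⊤ : ℕ∞) u)
    (hp : ContDiff ℝ (⊤ : ℕ∞) p) (hW : ContDiff ℝ 1 W) (i : Fin 3) :
    ContDiff ℝ 1 (verticalFlux u p W i) := by
  have h := (contDiff_pd (contDiff_comp_apply hu 2) i).of_le one_le_infty
  refine hW.mul (h.sub ?_)
  split_ifs
  · exact hp.of_le one_le_infty
  · exact contDiff_const

lemma sum_pd_energyFlux {δ : ℝ} {u b : V3 → V3} {p : V3 → ℝ} (hu : ContDiff ℝ (⊤ : ℕ∞) u)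
    (hp : ContDiff ℝ (⊤ : ℕ∞) p) (hsol : IsMHD δ u b p) (x : V3) :
    ∑ i, pd i (energyFlux u p i) x = -gradSq u x - ∑ i, u x i * transport u b i x := by
  have h := contDiff_comp_apply hu
  have du : ∀ j, Differentiable ℝ fun y => u y j := fun j => (h j).differentiable (by simp)
  have dd : ∀ i j, Differentiable ℝ (pd i fun y => u y j) := fun i j =>
    (contDiff_pd (h j) i).differentiable (by simp)
  have dp : Differentiable ℝ p := hp.differentiable (by simp)
  have e : ∀ i, pd i (energyFlux u p i) x = p x * pd i (fun y => u y i) x + u x i * pd i p x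
      - ∑ j, (u x j * pd i (pd i fun y => u y j) x
        + pd i (fun y => u y j) x * pd i (fun y => u y j) x) := by
    intro i
    unfold energyFlux
    rw [pd_sub ((dp x).fun_mul (du i x))
      (DifferentiableAt.fun_sum fun j _ => (du j x).fun_mul (dd i j x)), pd_mul (dp x) (du i x),
      pd_sum fun j => (du j x).fun_mul (dd i j x)]
    simp only [pd_mul (du _ x) (dd _ _ x)]
  have hd := hsol.2.2.1 x
  simp only [e, momentum_pd_pressure hsol, transport, gradSq, lap]
  simp only [Fin.sum_univ_three] at hd ⊢
  linear_combination p x * hd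

lemma sum_pd_verticalFlux {δ : ℝ} {u b : V3 → V3} {p W : V3 → ℝ} (hu : ContDiff ℝ (⊤ : ℕ∞) u)
    (hp : ContDiff ℝ (⊤ : ℕ∞) p) (hsol : IsMHD δ u b p) (hW : ContDiff ℝ 1 W) (x : V3) :
    ∑ i, pd i (verticalFlux u p W i) x = W x * transport u b 2 x
      + (∑ i, pd i W x * pd i (fun y => u y 2) x) - p x * pd 2 W x := by
  have h := contDiff_comp_apply hu 2
  have dd : ∀ i, Differentiable ℝ (pd i fun y => u y 2) := fun i =>
    (contDiff_pd h i).differentiable (by simp)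
  have dp : Differentiable ℝ p := hp.differentiable (by simp)
  have dW : Differentiable ℝ W := hW.differentiable (by simp)
  have dz : Differentiable ℝ fun _ : V3 => (0:ℝ) := by fun_prop
  have z : ∀ i, pd i (fun _ => (0:ℝ)) x = 0 := fun i => by simp [pd]
  have e0 : pd 0 (verticalFlux u p W 0) x = W x * pd 0 (pd 0 fun y => u y 2) x
      + pd 0 (fun y => u y 2) x * pd 0 W x := by
    have := pd_mul (dW x) ((dd 0 x).fun_sub (dz x)) 0
    rw [pd_sub (dd 0 x) (dz x), z, sub_zero, sub_zero] at this
    exact this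
  have e1 : pd 1 (verticalFlux u p W 1) x = W x * pd 1 (pd 1 fun y => u y 2) x
      + pd 1 (fun y => u y 2) x * pd 1 W x := by
    have := pd_mul (dW x) ((dd 1 x).fun_sub (dz x)) 1
    rw [pd_sub (dd 1 x) (dz x), z, sub_zero, sub_zero] at this
    exact this
  have e2 : pd 2 (verticalFlux u p W 2) x = W x * (pd 2 (pd 2 fun y => u y 2) x - pd 2 p x)
      + (pd 2 (fun y => u y 2) x - p x) * pd 2 W x := by
    have := pd_mul (dW x) ((dd 2 x).fun_sub (dp x)) 2
    rw [pd_sub (dd 2 x) (dp x)] at this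
    exact this
  rw [Fin.sum_univ_three, e0, e1, e2, momentum_pd_pressure hsol, transport, lap]
  simp only [Fin.sum_univ_three]
  ring

/-! ### Pointwise bounds -/

lemma abs_pd_le_sqrt_gradSq (u : V3 → V3) (x : V3) (i j : Fin 3) :
    |pd i (fun y => u y j) x| ≤ Real.sqrt (gradSq u x) := by
  refine Real.abs_le_sqrt ?_
  unfold gradSq
  refine le_trans ?_ (Finset.single_le_sum (f := fun i => ∑ j, pd i (fun y => u y j) x ^ 2)
    (fun i _ => Finset.sum_nonneg fun j _ => sq_nonneg _) (Finset.mem_univ i))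
  exact Finset.single_le_sum (f := fun j => pd i (fun y => u y j) x ^ 2)
    (fun j _ => sq_nonneg _) (Finset.mem_univ j)

lemma gradSq_nonneg (u : V3 → V3) (x : V3) : 0 ≤ gradSq u x :=
  Finset.sum_nonneg fun _ _ => Finset.sum_nonneg fun _ _ => sq_nonneg _

lemma contDiff_gradSq {u : V3 → V3} (hu : ContDiff ℝ (⊤ : ℕ∞) u) :
    ContDiff ℝ (⊤ : ℕ∞) (gradSq u) :=
  ContDiff.sum fun i _ => ContDiff.sum fun j _ => (contDiff_pd (contDiff_comp_apply hu j) i).pow 2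

lemma abs_sum_mul_le {M S : ℝ} {v w : Fin 3 → ℝ} (hv : ∀ i, |v i| ≤ M) (hw : ∀ i, |w i| ≤ S) :
    |∑ i, v i * w i| ≤ 3 * (M * S) := by
  refine (Finset.abs_sum_le_sum_abs _ _).trans ?_
  refine (Finset.sum_le_sum (g := fun _ => M * S) fun i _ => ?_).trans (by simp)
  rw [abs_mul]
  exact mul_le_mul (hv i) (hw i) (abs_nonneg _) ((abs_nonneg _).trans (hv i))

lemma abs_transport_le {u b : V3 → V3} {x : V3} {M S : ℝ} (hu : ∀ i, |u x i| ≤ M)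
    (hb : ∀ i, |b x i| ≤ M) (du : ∀ i j, |pd i (fun y => u y j) x| ≤ S)
    (db : ∀ i j, |pd i (fun y => b y j) x| ≤ S) (i : Fin 3) :
    |transport u b i x| ≤ 6 * (M * S) := by
  have h1 := abs_sum_mul_le hu fun j => du j i
  have h2 := abs_sum_mul_le hb fun j => db j i
  refine (abs_sub _ _).trans ?_
  linarith

lemma abs_coord_le_nr (x : V3) : |x 0| ≤ nr x ∧ |x 1| ≤ nr x :=
  ⟨Real.abs_le_sqrt (by nlinarith [sq_nonneg (x 1)]), Real.abs_le_sqrt (by nlinarith [sq_nonneg (x 0)])⟩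

lemma abs_coord_combination_le (x : V3) {a c K : ℝ} (ha : |a| ≤ K) (hc : |c| ≤ K) :
    |x 0 * a + x 1 * c| ≤ 2 * (nr x * K) := by
  obtain ⟨h0, h1⟩ := abs_coord_le_nr x
  have hn := nr_nonneg x
  calc _ ≤ |x 0| * |a| + |x 1| * |c| := by
        rw [← abs_mul, ← abs_mul]
        exact abs_add_le _ _
    _ ≤ nr x * K + nr x * K := by gcongr
    _ = _ := by ring

lemma abs_coord_combination_div_le {x : V3} (hx : 0 < nr x) {a c K : ℝ} (ha : |a| ≤ K)
    (hc : |c| ≤ K) : |(x 0 * a + x 1 * c) / nr x| ≤ 2 * K := by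
  rw [abs_div, abs_of_pos hx, div_le_iff₀ hx]
  linarith [abs_coord_combination_le x ha hc]

lemma abs_primZ_le {k : V3 → ℝ} {x : V3} {K : ℝ} (h0 : 0 ≤ x 2) (h1 : x 2 ≤ 1)
    (hk : ∀ s, |k ![x 0, x 1, s]| ≤ K) : |primZ k x| ≤ K := by
  have h := intervalIntegral.norm_integral_le_of_norm_le_const (a := 0) (b := x 2) (C := K)
    (f := fun s => k ![x 0, x 1, s]) fun s _ => hk s
  rw [sub_zero, abs_of_nonneg h0] at h
  have hK : 0 ≤ K := (abs_nonneg _).trans (hk 0)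
  exact h.trans (mul_le_of_le_one_right hK h1)

lemma nr_vec (x : V3) (s : ℝ) : nr ![x 0, x 1, s] = nr x := by simp [nr]

/-- The horizontal derivatives of the primitive of `r u^r`, tested against a number `a`. -/
lemma abs_mul_primZ_pd_radial_le {u : V3 → V3} (hu : ContDiff ℝ (⊤ : ℕ∞) u) {M : ℝ}
    (hM : ∀ i x, |u x i| ≤ M) {x : V3} (h0 : 0 ≤ x 2) (h1 : x 2 ≤ 1) {i : Fin 3} (hi : i ≠ 2)
    (a : ℝ) :
    |primZ (pd i fun y => y 0 * u y 0 + y 1 * u y 1) x * a|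
      ≤ M * |a| + nr x * (a ^ 2 + fiberInt (gradSq u) x) := by
  set g : V3 → ℝ := fun y => y 0 * u y 0 + y 1 * u y 1 with hg
  have hkc : Continuous (gradSq u) := (contDiff_gradSq hu).continuous
  have cg : Continuous (pd i g) := continuous_pd ((contDiff_radial hu).of_le one_le_infty) i
  have hpt : ∀ s, |pd i g ![x 0, x 1, s] * a|
      ≤ M * |a| + nr x * (a ^ 2 + gradSq u ![x 0, x 1, s]) := by
    intro s
    set y : V3 := ![x 0, x 1, s]
    have hn : nr y = nr x := nr_vec x s
    have hn0 := nr_nonneg x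
    have e : |pd i g y| ≤ M + 2 * (nr x * Real.sqrt (gradSq u y)) := by
      rw [hg, pd_radial hu, ← hn]
      have h2 := abs_coord_combination_le y (abs_pd_le_sqrt_gradSq u y i 0)
        (abs_pd_le_sqrt_gradSq u y i 1)
      have h3 : |u y 0 * (if 0 = i then 1 else 0) + u y 1 * (if 1 = i then 1 else 0)| ≤ M := by
        fin_cases i
        · simpa using hM 0 y
        · simpa using hM 1 y
        · exact absurd rfl hi
      calc _ = |(u y 0 * (if 0 = i then 1 else 0) + u y 1 * (if 1 = i then 1 else 0))
            + (y 0 * pd i (fun y => u y 0) y + y 1 * pd i (fun y => u y 1) y)| := by ring_nf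
        _ ≤ _ := (abs_add_le _ _).trans (add_le_add h3 h2)
    have hs := Real.sq_sqrt (gradSq_nonneg u y)
    have h2 : 2 * (Real.sqrt (gradSq u y) * |a|) ≤ a ^ 2 + gradSq u y := by
      nlinarith [sq_nonneg (Real.sqrt (gradSq u y) - |a|), sq_abs a]
    calc |pd i g y * a| ≤ (M + 2 * (nr x * Real.sqrt (gradSq u y))) * |a| := by
          rw [abs_mul]; gcongr
      _ = M * |a| + nr x * (2 * (Real.sqrt (gradSq u y) * |a|)) := by ring
      _ ≤ _ := by gcongr
  have hint : ∀ c d, IntervalIntegrable (fun s => M * |a| + nr x * (a ^ 2 + gradSq u ![x 0, x 1, s]))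
      volume c d := fun c d => by
    have := continuous_slice hkc x
    exact Continuous.intervalIntegrable (by fun_prop) c d
  have hnn : ∀ s, 0 ≤ M * |a| + nr x * (a ^ 2 + gradSq u ![x 0, x 1, s]) := fun s =>
    (abs_nonneg _).trans (hpt s)
  rw [primZ, ← intervalIntegral.integral_mul_const, ← Real.norm_eq_abs]
  calc _ ≤ ∫ s in (0:ℝ)..x 2, (M * |a| + nr x * (a ^ 2 + gradSq u ![x 0, x 1, s])) :=
        intervalIntegral.norm_integral_le_of_norm_le h0
          (Filter.Eventually.of_forall fun s _ => hpt s) (hint _ _)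
    _ ≤ ∫ s in (0:ℝ)..1, (M * |a| + nr x * (a ^ 2 + gradSq u ![x 0, x 1, s])) :=
        intervalIntegral.integral_mono_interval le_rfl h0 h1
          (Filter.Eventually.of_forall hnn) (hint _ _)
    _ = _ := by
        have hk := (continuous_slice hkc x).intervalIntegrable (μ := volume) 0 1
        have hc : ∀ c : ℝ, IntervalIntegrable (fun _ => c) volume 0 1 := fun c => by simp
        rw [intervalIntegral.integral_add (hc (M * |a|)) (((hc (a ^ 2)).add hk).const_mul (nr x)),
          intervalIntegral.integral_const_mul (nr x), intervalIntegral.integral_add (hc (a ^ 2)) hk]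
        simp [fiberInt, primZ]

/-! ### Radial weights -/

/-- The normalised parabolic bump on `[R - 1, R]`. -/
def bump (R r : ℝ) : ℝ := 6 * ((r - (R - 1)) * (R - r))

/-- The primitive of `1 - bump R` vanishing at both ends of `[R - 1, R]`. -/
def bumpPrim (R r : ℝ) : ℝ := (r - (R - 1)) * (R - r) * (2 * (R - r) - 1)

lemma hasDerivAt_bump (R r : ℝ) : HasDerivAt (bump R) (6 * (2 * (R - r) - 1)) r := by
  have h := (((hasDerivAt_id r).sub_const (R - 1)).mul ((hasDerivAt_id r).const_sub R)).const_mul 6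
  refine h.congr_deriv ?_
  simp only [id]
  ring

lemma hasDerivAt_bumpPrim (R r : ℝ) : HasDerivAt (bumpPrim R) (1 - bump R r) r := by
  have h := (((hasDerivAt_id r).sub_const (R - 1)).mul ((hasDerivAt_id r).const_sub R)).mul
    ((((hasDerivAt_id r).const_sub R).const_mul 2).sub_const 1)
  refine h.congr_deriv ?_
  simp only [id, bump, Pi.mul_apply]
  ring

/-- The derivative of `bump R r / r`. -/
def bumpDivDeriv (R r : ℝ) : ℝ := (6 * (2 * (R - r) - 1) * r - bump R r) / r ^ 2

lemma hasDerivAt_bump_div {R r : ℝ} (hr : r ≠ 0) :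
    HasDerivAt (fun r => bump R r / r) (bumpDivDeriv R r) r := by
  have h := (hasDerivAt_bump R r).div (hasDerivAt_id r) hr
  refine h.congr_deriv ?_
  simp [bumpDivDeriv]

lemma bump_mem {R r : ℝ} (hr : r ∈ Set.Icc (R - 1) R) : 0 ≤ bump R r ∧ bump R r ≤ 3 / 2 := by
  obtain ⟨h0, h1⟩ := hr
  have := mul_nonneg (sub_nonneg.2 h0) (sub_nonneg.2 h1)
  unfold bump
  constructor <;> nlinarith [sq_nonneg (r - (R - 1) - (R - r))]

lemma abs_bumpPrim_le {R r : ℝ} (hr : r ∈ Set.Icc (R - 1) R) : |bumpPrim R r| ≤ 1 := by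
  have h := bump_mem hr
  unfold bump at h
  have h2 : |2 * (R - r) - 1| ≤ 1 := abs_le.2 ⟨by linarith [hr.2], by linarith [hr.1]⟩
  rw [bumpPrim, abs_mul, abs_of_nonneg (by linarith)]
  exact mul_le_one₀ (by linarith) (abs_nonneg _) h2

lemma abs_bumpDivDeriv_le {R r : ℝ} (hR : 2 ≤ R) (hr : r ∈ Set.Icc (R - 1) R) :
    |bumpDivDeriv R r| * r ≤ 15 / 2 := by
  have h := bump_mem hr
  have h1 : 1 ≤ r := by linarith [hr.1]
  have h2 : |2 * (R - r) - 1| ≤ 1 := abs_le.2 ⟨by linarith [hr.2], by linarith [hr.1]⟩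
  rw [bumpDivDeriv, abs_div, abs_of_nonneg (sq_nonneg r), div_mul_eq_mul_div,
    div_le_iff₀ (by positivity)]
  have h3 : |6 * (2 * (R - r) - 1) * r - bump R r| ≤ 6 * r + 3 / 2 := by
    refine (abs_sub _ _).trans ?_
    rw [abs_of_nonneg h.1, abs_mul, abs_mul, abs_of_nonneg (by linarith : 0 ≤ r),
      abs_of_nonneg (by norm_num : (0:ℝ) ≤ 6)]
    nlinarith
  nlinarith

lemma continuousOn_bumpDivDeriv {R : ℝ} (hR : 2 ≤ R) :
    ContinuousOn (bumpDivDeriv R) (Set.Icc (R - 1) R) := by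
  unfold bumpDivDeriv bump
  refine ContinuousOn.div (by fun_prop) (by fun_prop) fun r hr => ?_
  have : 0 < r := by linarith [hr.1]
  positivity

/-! ### The estimate -/

/-- The pointwise bound left after subtracting the two divergence identities. -/
lemma abs_pressure_remainder_le {M S gS m n ψ χ Q' D E W T d0 d1 a2 P L g : ℝ} (hn : 1 ≤ n)
    (hS : 0 ≤ S) (hM : 0 ≤ M) (hψ : |ψ| ≤ 1) (hχ : 0 ≤ χ ∧ χ ≤ 3 / 2)
    (hQ' : |Q'| * n ≤ 15 / 2) (hD : |D| ≤ gS + 18 * (M * M * S)) (hE : |E| ≤ 6 * (M * S))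
    (hW : |W| ≤ 2 * (n * M)) (hT : |T| ≤ 6 * (M * S))
    (hd0 : |d0| ≤ M * S + n * (gS + m)) (hd1 : |d1| ≤ M * S + n * (gS + m))
    (hg : |g / n| ≤ 2 * M) (ha2 : |a2| ≤ S) (hL : |L| ≤ 2 * S) :
    |P * (g / n) - (ψ * D + (1 - χ) * (P * (g / n) - E))
      + (χ / n * (W * T + (d0 + d1 + g * a2) - P * g) + Q' * (W * L))|
      ≤ (36 * M ^ 2 + 42 * M) * S + 4 * gS + 3 * m := by
  have hn0 : 0 < n := by linarith
  have e : P * (g / n) - (ψ * D + (1 - χ) * (P * (g / n) - E))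
      + (χ / n * (W * T + (d0 + d1 + g * a2) - P * g) + Q' * (W * L))
      = -(ψ * D) + (1 - χ) * E + χ / n * W * T + χ / n * (d0 + d1) + χ * (g / n) * a2
        + Q' * W * L := by ring
  have hMS : 0 ≤ M * S := mul_nonneg hM hS
  have hχn : |χ / n| = χ / n := abs_of_nonneg (div_nonneg hχ.1 hn0.le)
  have hχn2 : χ / n ≤ 3 / 2 / n := by gcongr; exact hχ.2
  have b1 : |ψ * D| ≤ gS + 18 * (M * M * S) := by
    rw [abs_mul]
    exact (mul_le_of_le_one_left (abs_nonneg _) hψ).trans hD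
  have b2 : |(1 - χ) * E| ≤ 6 * (M * S) := by
    rw [abs_mul]
    exact (mul_le_of_le_one_left (abs_nonneg _)
      (abs_le.2 ⟨by linarith [hχ.2], by linarith [hχ.1]⟩)).trans hE
  have hχW : |χ / n * W| ≤ 3 * M := by
    rw [abs_mul, hχn]
    calc _ ≤ 3 / 2 / n * (2 * (n * M)) := by gcongr
      _ = 3 * M := by field_simp
  have b3 : |χ / n * W * T| ≤ 18 * (M * M * S) := by
    rw [abs_mul]
    calc _ ≤ 3 * M * (6 * (M * S)) := by gcongr
      _ = _ := by ring
  have b4 : |χ / n * (d0 + d1)| ≤ 3 * (M * S) + 3 * (gS + m) := by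
    rw [abs_mul, hχn]
    calc _ ≤ 3 / 2 / n * (2 * (M * S + n * (gS + m))) := by
          gcongr
          linarith [abs_add_le d0 d1]
      _ = 3 * (M * S) / n + 3 * (gS + m) := by field_simp
      _ ≤ _ := by
          gcongr
          exact div_le_self (by positivity) hn
  have b5 : |χ * (g / n) * a2| ≤ 3 * (M * S) := by
    rw [abs_mul, abs_mul, abs_of_nonneg hχ.1]
    calc _ ≤ 3 / 2 * (2 * M) * S := by
          gcongr
          exact hχ.2
      _ = _ := by ring
  have b6 : |Q' * W * L| ≤ 30 * (M * S) := by
    rw [abs_mul, abs_mul]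
    calc _ ≤ |Q'| * (2 * (n * M)) * (2 * S) := by gcongr
      _ = |Q'| * n * (4 * (M * S)) := by ring
      _ ≤ 15 / 2 * (4 * (M * S)) := by gcongr
      _ = _ := by ring
  rw [e]
  rw [abs_le] at b1 b2 b3 b4 b5 b6 ⊢
  constructor <;> linarith

/-- Estimate for the pressure term `I₃` under axisymmetry of the
swirl components. -/
theorem pressure_term_estimate (δ : ℝ) (hδ : δ ∈ Set.Icc (0:ℝ) 1)
    (u b : V3 → V3) (p : V3 → ℝ)
    (hu : ContDiff ℝ (⊤ : ℕ∞) u) (hb : ContDiff ℝ (⊤ : ℕ∞) b) (hp : ContDiff ℝ (⊤ : ℕ∞) p)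
    (hubd : Bounded3 u) (hbbd : Bounded3 b)
    (hup : PeriodicZ u) (hbp : PeriodicZ b)
    (hsol : IsMHD δ u b p)
    (haxu : AxiSym (compTheta u)) (haxb : AxiSym (compTheta b)) :
    ∃ C > (0:ℝ), ∀ R ≥ (2:ℝ),
      |∫ x in OR R,
          (p x - (volume (OR R)).toReal⁻¹ * ∫ y in OR R, p y) * ur u x|
        ≤ C * Real.sqrt R * Real.sqrt (∫ x in OR R, (gradSq u x + gradSq b x))
          + C * ∫ x in OR R, gradSq u x := by
  obtain ⟨M₁, hM₁⟩ := hubd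
  obtain ⟨M₂, hM₂⟩ := hbbd
  set M := max M₁ M₂
  have bu : ∀ j x, |u x j| ≤ M := fun j x =>
    (norm_le_pi_norm (u x) j).trans ((hM₁ x).trans (le_max_left _ _))
  have bb : ∀ j x, |b x j| ≤ M := fun j x =>
    (norm_le_pi_norm (b x) j).trans ((hM₂ x).trans (le_max_right _ _))
  have hM : 0 ≤ M := (abs_nonneg _).trans (bu 0 0)
  set g : V3 → ℝ := fun y => y 0 * u y 0 + y 1 * u y 1 with hg_def
  have hg : ContDiff ℝ 1 g := (contDiff_radial hu).of_le one_le_infty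
  have hW : ContDiff ℝ 1 (primZ g) := contDiff_primZ hg
  have ku : ContDiff ℝ 1 (gradSq u) := (contDiff_gradSq hu).of_le one_le_infty
  have cs : Continuous fun x => gradSq u x + gradSq b x :=
    ku.continuous.add (contDiff_gradSq hb).continuous
  refine ⟨3 * (36 * M ^ 2 + 42 * M) + 7, by positivity, fun R hR => ?_⟩
  have hcomp : ∀ {f : V3 → ℝ}, Continuous f → IntegrableOn f (OR R) := fun hf =>
    hf.continuousOn.integrableOn_compact (isCompact_OR R)
  have hurc : ContinuousOn (ur u) (OR R) := by
    unfold ur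
    exact hg.continuous.continuousOn.div continuous_nr.continuousOn fun x hx => by
      linarith [one_le_nr hR hx]
  have i_ur : IntegrableOn (ur u) (OR R) := hurc.integrableOn_compact (isCompact_OR R)
  have i_pur : IntegrableOn (fun x => p x * ur u x) (OR R) :=
    (hp.continuous.continuousOn.mul hurc).integrableOn_compact (isCompact_OR R)
  have hmean : ∀ c : ℝ, ∫ x in OR R, (p x - c) * ur u x = ∫ x in OR R, p x * ur u x := by
    intro c
    simp only [sub_mul]
    rw [integral_sub i_pur (i_ur.const_mul c), integral_const_mul,
      integral_OR_ur hu hup hsol.2.2.1 haxu hR, mul_zero, sub_zero]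
  rw [hmean]
  have hG := contDiff_energyFlux hu hp
  have hH := contDiff_verticalFlux hu hp hW
  have hζ₁ : ∀ r ∈ Set.Icc (R - 1) R, HasDerivAt (bumpPrim R) (1 - bump R r) r :=
    fun r _ => hasDerivAt_bumpPrim R r
  have hζ₂ : ∀ r ∈ Set.Icc (R - 1) R, HasDerivAt (fun r => bump R r / r) (bumpDivDeriv R r) r :=
    fun r hr => hasDerivAt_bump_div (by linarith [hr.1])
  have hζ₁c : ContinuousOn (fun r => 1 - bump R r) (Set.Icc (R - 1) R) := by
    unfold bump
    fun_prop
  have hper : ∀ x : V3, ∀ {f : V3 → ℝ}, (∀ y, f (y + Pi.single 2 1) = f y) →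
      f ![x 0, x 1, 1] = f ![x 0, x 1, 0] := fun x f hf => by
    rw [← hf ![x 0, x 1, 0], ← vec_add_one]
    simp
  have hu' : ∀ x, u (x + Pi.single 2 1) = u x := fun x => by rw [← vec_add_one, hup]
  have hpper := pressure_periodic hu hb hp ⟨M₁, hM₁⟩ ⟨M₂, hM₂⟩ hup hbp hsol
  have E₁ := integral_OR_divergence hR hG hζ₁ hζ₁c
    (fun x hx => by rcases hx with h | h <;> simp [bumpPrim, h])
    (fun x => hper x fun y => by
      have h : ∀ j, pd 2 (fun z => u z j) (y + Pi.single 2 1) = pd 2 (fun z => u z j) y :=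
        fun j => pd_shift (fun x => by rw [hu']) 2 y
      simp only [energyFlux, hpper, hu', h])
  have E₂ := integral_OR_divergence hR hH hζ₂ (continuousOn_bumpDivDeriv hR)
    (fun x hx => by rcases hx with h | h <;> simp [bump, h])
    (fun x => by
      simp only [verticalFlux]
      rw [primZ_radial_eq_zero hu hup hsol.2.2.1 haxu rfl, primZ_zero _ rfl, zero_mul, zero_mul])
  have I₁ := integrableOn_OR_divergence hR hG
    (fun r hr => (hζ₁ r hr).continuousAt.continuousWithinAt) hζ₁c
  have I₂ := integrableOn_OR_divergence hR hH
    (fun r hr => (hζ₂ r hr).continuousAt.continuousWithinAt) (continuousOn_bumpDivDeriv hR)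
  have i1 := (hcomp cs.sqrt).const_mul (36 * M ^ 2 + 42 * M)
  have i2 := (hcomp ku.continuous).const_mul 4
  have i3 := (hcomp (contDiff_fiberInt ku).continuous).const_mul 3
  have hle := abs_setIntegral_le_of_integral_eq_zero (measurableSet_OR R) i_pur I₁ I₂
    ((i1.add i2).add i3) E₁ E₂ (by
      intro x hx
      have hn := one_le_nr hR hx
      have hn0 : 0 < nr x := by linarith
      have hr : nr x ∈ Set.Icc (R - 1) R := hx.2
      set S := Real.sqrt (gradSq u x + gradSq b x) with hS_def
      have hS : 0 ≤ S := Real.sqrt_nonneg _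
      have du : ∀ i j, |pd i (fun y => u y j) x| ≤ S := fun i j =>
        (abs_pd_le_sqrt_gradSq u x i j).trans (Real.sqrt_le_sqrt (by linarith [gradSq_nonneg b x]))
      have db : ∀ i j, |pd i (fun y => b y j) x| ≤ S := fun i j =>
        (abs_pd_le_sqrt_gradSq b x i j).trans (Real.sqrt_le_sqrt (by linarith [gradSq_nonneg u x]))
      have bT := abs_transport_le (fun i => bu i x) (fun i => bb i x) du db
      have dsq : ∀ i, pd i (fun y => u y 2) x ^ 2 ≤ gradSq u x := fun i => by
        rw [← Real.sq_sqrt (gradSq_nonneg u x), ← sq_abs]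
        exact pow_le_pow_left₀ (abs_nonneg _) (abs_pd_le_sqrt_gradSq u x i 2) 2
      have hd : ∀ i : Fin 3, i ≠ 2 → |pd i (primZ g) x * pd i (fun y => u y 2) x|
          ≤ M * S + nr x * (gradSq u x + fiberInt (gradSq u) x) := fun i hi => by
        rw [pd_primZ_horizontal hg hi]
        refine (abs_mul_primZ_pd_radial_le hu bu hx.1.1 hx.1.2 hi _).trans ?_
        gcongr
        · exact du i 2
        · exact dsq i
      have hD : |(-gradSq u x - ∑ i, u x i * transport u b i x)|
          ≤ gradSq u x + 18 * (M * M * S) := by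
        have := abs_sum_mul_le (fun i => bu i x) bT
        refine (abs_sub _ _).trans ?_
        rw [abs_neg, abs_of_nonneg (gradSq_nonneg u x)]
        nlinarith
      have he : ∀ i, |∑ j, u x j * pd i (fun z => u z j) x| ≤ 3 * (M * S) := fun i =>
        abs_sum_mul_le (fun j => bu j x) fun j => du i j
      have key := abs_pressure_remainder_le (P := p x) hn hS hM
        (abs_bumpPrim_le hr) (bump_mem hr)
        (abs_bumpDivDeriv_le hR hr) hD
        ((abs_coord_combination_div_le hn0 (he 0) (he 1)).trans_eq (by ring))
        (abs_primZ_le (k := g) (K := 2 * (nr x * M)) hx.1.1 hx.1.2 fun s => by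
          have := abs_coord_combination_le ![x 0, x 1, s] (bu 0 ![x 0, x 1, s])
            (bu 1 ![x 0, x 1, s])
          rwa [nr_vec] at this) (bT 2) (hd 0 (by decide)) (hd 1 (by decide))
        (abs_coord_combination_div_le hn0 (bu 0 x) (bu 1 x)) (du 2 2)
        (abs_coord_combination_div_le hn0 (du 0 2) (du 1 2))
      rw [sum_pd_energyFlux hu hp hsol, sum_pd_verticalFlux hu hp hsol hW, pd_primZ_two hg]
      refine le_trans (le_of_eq ?_) key
      congr 1
      rw [Fin.sum_univ_three (fun i => pd i (primZ g) x * _), pd_primZ_two hg]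
      simp only [energyFlux, verticalFlux, ur, hg_def]
      simp
      field_simp
      ring)
  have i12 : IntegrableOn (fun x => (36 * M ^ 2 + 42 * M) * Real.sqrt (gradSq u x + gradSq b x)
    + 4 * gradSq u x) (OR R) := i1.add i2
  refine hle.trans ?_
  have hgU : 0 ≤ ∫ x in OR R, gradSq u x := integral_nonneg fun x => gradSq_nonneg u x
  have hcs := integral_OR_sqrt_le hR cs fun x => add_nonneg (gradSq_nonneg u x) (gradSq_nonneg b x)
  simp only [Pi.add_apply]
  rw [integral_add i12 i3, integral_add i1 i2, integral_const_mul, integral_const_mul,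
    integral_const_mul, integral_OR_fiberInt ku hR]
  have hK : 0 ≤ 36 * M ^ 2 + 42 * M := by positivity
  have hKcs := mul_le_mul_of_nonneg_left hcs hK
  have hrt : 0 ≤ Real.sqrt R * Real.sqrt (∫ x in OR R, (gradSq u x + gradSq b x)) := by positivity
  nlinarith [mul_nonneg hK hgU]
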